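/- Let Ω = (0,1)² ⊆ ℝ² and let φ be the crystalline norm φ(ν) = |ν₁| + |ν₂| on ℝ², whose Wulff shape is W_φ = {(x,y) : |x|+|y| < 1}. Let u be a minimizer of problem (1) with mass m, let j̄ = ‖u‖_∞, and let E_j = {u ≥ j}. Then: (i) if m ∈ (0, 1/2], then j̄ = 1 and cl(E₁) = cl(W_r(x₀)) ⊆ [0,1]² for some x₀, with r = √(m/2); (ii) if m ∈ [1/2, 1), then j̄ = 1 and cl(E₁) = cl(Ω^r), with r = √((1−m)/2); (iii) if m = 1, then either j̄ = 1 and cl(E₁) = cl(Ω), or j̄ = 2 with cl(E₁) = cl(Ω^r) and cl(E₂) = cl(W_r(x₀)) ⊆ cl(Ω) for some x₀ and some r ∈ (0, 1/2]. -/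

import Mathlib

open MeasureTheory Set ENNReal Filter

noncomputable section

/-- `φ` is a norm on `ℝⁿ` (represented as `Fin n → ℝ`). -/
structure IsNorm {n : ℕ} (φ : (Fin n → ℝ) → ℝ) : Prop where
  nonneg : ∀ x, 0 ≤ φ x
  eq_zero_iff : ∀ x, φ x = 0 ↔ x = 0
  smul_eq : ∀ (a : ℝ) (x : Fin n → ℝ), φ (a • x) = |a| * φ x
  add_le : ∀ x y, φ (x + y) ≤ φ x + φ y

/-- The divergence of a vector field `η : ℝⁿ → ℝⁿ`. -/
def diverg {n : ℕ} (η : (Fin n → ℝ) → (Fin n → ℝ)) (x : Fin n → ℝ) : ℝ :=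
  ∑ i, fderiv ℝ η x (Pi.single i 1) i

/-- The anisotropic total variation `∫ φ*(Du)` of `u : ℝⁿ → ℝ`:
`sup { ∫ u div η dx : η ∈ C¹_c(ℝⁿ;ℝⁿ), φ(η(x)) ≤ 1 ∀ x }`, as an extended real. -/
def anisoTV {n : ℕ} (φ : (Fin n → ℝ) → ℝ) (u : (Fin n → ℝ) → ℝ) : ℝ≥0∞ :=
  ⨆ η ∈ {η : (Fin n → ℝ) → (Fin n → ℝ) |
      ContDiff ℝ 1 η ∧ HasCompactSupport η ∧ ∀ x, φ (η x) ≤ 1},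
    ENNReal.ofReal (∫ x, u x * diverg η x)

/-- `u ∈ BV(ℝⁿ)` (with respect to the anisotropic total variation). -/
def IsBV {n : ℕ} (φ : (Fin n → ℝ) → ℝ) (u : (Fin n → ℝ) → ℝ) : Prop :=
  Integrable u volume ∧ anisoTV φ u ≠ ⊤

/-- `u` is admissible for problem (1): `u ∈ BV(ℝⁿ)`, `u = 0` a.e. outside `Ω`,
`u` is a.e. `ℕ`-valued, and `∫_Ω u = m`. -/
def Admissible {n : ℕ} (φ : (Fin n → ℝ) → ℝ) (Ω : Set (Fin n → ℝ)) (m : ℝ)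
    (u : (Fin n → ℝ) → ℝ) : Prop :=
  IsBV φ u ∧ (∀ᵐ x ∂volume, x ∉ Ω → u x = 0) ∧
    (∀ᵐ x ∂volume, ∃ k : ℕ, u x = k) ∧ (∫ x in Ω, u x) = m

/-- `u` is a minimizer of problem (1). -/
def IsMinimizer {n : ℕ} (φ : (Fin n → ℝ) → ℝ) (Ω : Set (Fin n → ℝ)) (m : ℝ)
    (u : (Fin n → ℝ) → ℝ) : Prop :=
  Admissible φ Ω m u ∧ ∀ v, Admissible φ Ω m v → anisoTV φ u ≤ anisoTV φ v

/-- The anisotropic perimeter `P_φ(E)` of a set `E ⊆ ℝⁿ`. -/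
def anisoPerimeter {n : ℕ} (φ : (Fin n → ℝ) → ℝ) (E : Set (Fin n → ℝ)) : ℝ≥0∞ :=
  anisoTV φ (E.indicator (1 : (Fin n → ℝ) → ℝ))

/-- The Wulff ball `W_r(x) = {y : φ(y-x) < r}`. -/
def wulffBall {n : ℕ} (φ : (Fin n → ℝ) → ℝ) (x : Fin n → ℝ) (r : ℝ) : Set (Fin n → ℝ) :=
  {y | φ (y - x) < r}

/-- `E` satisfies the `rW_φ`-condition. -/
def rWCond {n : ℕ} (φ : (Fin n → ℝ) → ℝ) (E : Set (Fin n → ℝ)) (r : ℝ) : Prop :=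
  ∀ x ∈ frontier E, ∃ y, wulffBall φ y r ⊆ E ∧ x ∈ frontier (wulffBall φ y r)

/-- The Wulff plaquette `E^r`, the union of all Wulff balls of radius `r` contained
in `E` (with `E^0 = E`). -/
def plaquette {n : ℕ} (φ : (Fin n → ℝ) → ℝ) (E : Set (Fin n → ℝ)) (r : ℝ) :
    Set (Fin n → ℝ) :=
  if r = 0 then E else ⋃ (x) (_ : wulffBall φ x r ⊆ E), wulffBall φ x r

/-- `R_Ω`: the maximal `R > 0` such that some Wulff ball of radius `R` is contained in `Ω`. -/
def maxInradius {n : ℕ} (φ : (Fin n → ℝ) → ℝ) (Ω : Set (Fin n → ℝ)) : ℝ :=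
  sSup {R | 0 < R ∧ ∃ x, wulffBall φ x R ⊆ Ω}

/-- `r_Ω`: the maximal `r > 0` such that `Ω` satisfies the `rW_φ`-condition
(`0` if there is none, since `sSup ∅ = 0`). -/
def maxRollRadius {n : ℕ} (φ : (Fin n → ℝ) → ℝ) (Ω : Set (Fin n → ℝ)) : ℝ :=
  sSup {r | 0 < r ∧ rWCond φ Ω r}

/-- The set of points of Lebesgue density `1` of `E`. -/
def densityPoints {n : ℕ} (E : Set (Fin n → ℝ)) : Set (Fin n → ℝ) :=
  {x | Tendsto (fun r : ℝ => volume (E ∩ Metric.ball x r) / volume (Metric.ball x r))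
    (nhdsWithin 0 (Ioi 0)) (nhds 1)}

/-- `E` is a minimizer of problem (10): the constrained isoperimetric problem
minimizing `P_φ` among measurable subsets of `Ω` of prescribed measure `m`. -/
def IsIsopMinimizer {n : ℕ} (φ : (Fin n → ℝ) → ℝ) (Ω : Set (Fin n → ℝ)) (m : ℝ)
    (E : Set (Fin n → ℝ)) : Prop :=
  MeasurableSet E ∧ E ⊆ Ω ∧ (volume E).toReal = m ∧
    ∀ F, MeasurableSet F → F ⊆ Ω → (volume F).toReal = m →
      anisoPerimeter φ E ≤ anisoPerimeter φ F

/-- The Euclidean norm on `ℝ²`. -/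
def euclNorm (v : Fin 2 → ℝ) : ℝ := Real.sqrt (v 0 ^ 2 + v 1 ^ 2)

/-- The crystalline norm `φ(ν) = |ν₁| + |ν₂|` on `ℝ²`. -/
def crysNorm (v : Fin 2 → ℝ) : ℝ := |v 0| + |v 1|

/-- The open unit square `(0,1)² ⊆ ℝ²`. -/
def unitSquare : Set (Fin 2 → ℝ) := univ.pi fun _ => Ioo (0 : ℝ) 1

/-- The closed unit square `[0,1]² ⊆ ℝ²`. -/
def closedUnitSquare : Set (Fin 2 → ℝ) := univ.pi fun _ => Icc (0 : ℝ) 1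

/-- `j` is the essential supremum `‖u‖_∞` of `u`. -/
def IsEssSup (u : (Fin 2 → ℝ) → ℝ) (j : ℕ) : Prop :=
  (∀ᵐ x ∂volume, u x ≤ (j : ℝ)) ∧ ∀ c : ℝ, (∀ᵐ x ∂volume, u x ≤ c) → (j : ℝ) ≤ c

/-- Coordinates on the plane rotated by 45 degrees and centred at the centre of the unit square. -/
def toPlane (p : ℝ × ℝ) : Fin 2 → ℝ := ![(1 + p.1 + p.2) / 2, (1 + p.1 - p.2) / 2]

/-- The inverse of `toPlane`. -/
def ofPlane (x : Fin 2 → ℝ) : ℝ × ℝ := (x 0 + x 1 - 1, x 0 - x 1)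

@[simp] lemma toPlane_zero (p : ℝ × ℝ) : toPlane p 0 = (1 + p.1 + p.2) / 2 := rfl

@[simp] lemma toPlane_one (p : ℝ × ℝ) : toPlane p 1 = (1 + p.1 - p.2) / 2 := rfl

@[simp] lemma ofPlane_toPlane (p : ℝ × ℝ) : ofPlane (toPlane p) = p := by
  ext <;> simp [ofPlane] <;> ring

@[simp] lemma toPlane_ofPlane (x : Fin 2 → ℝ) : toPlane (ofPlane x) = x := by
  ext i; fin_cases i <;> simp [ofPlane]

lemma continuous_toPlane : Continuous toPlane := by
  refine continuous_pi fun i => ?_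
  fin_cases i <;> simp <;> fun_prop

lemma continuous_ofPlane : Continuous ofPlane := by
  unfold ofPlane; fun_prop

/-- The rotated coordinates as a homeomorphism. -/
def planeHomeo : (ℝ × ℝ) ≃ₜ (Fin 2 → ℝ) where
  toFun := toPlane
  invFun := ofPlane
  left_inv := ofPlane_toPlane
  right_inv := toPlane_ofPlane
  continuous_toFun := continuous_toPlane
  continuous_invFun := continuous_ofPlane

@[simp] lemma planeHomeo_apply (p : ℝ × ℝ) : planeHomeo p = toPlane p := rfl

@[simp] lemma planeHomeo_symm_apply (x : Fin 2 → ℝ) : planeHomeo.symm x = ofPlane x := rfl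

lemma map_toPlane_volume :
    Measure.map toPlane volume = (2 : ℝ≥0∞) • (volume : Measure (Fin 2 → ℝ)) := by
  let M : Matrix (Fin 2) (Fin 2) ℝ := !![1 / 2, 1 / 2; 1 / 2, -1 / 2]
  have hM : M.det = -1 / 2 := by simp [M, Matrix.det_fin_two]; norm_num
  have h1 := Real.map_matrix_volume_pi_eq_smul_volume_pi (M := M) (by rw [hM]; norm_num)
  have h2 := (volume_preserving_finTwoArrow ℝ).symm.map_eq
  have h3 : toPlane = (fun x : Fin 2 → ℝ => (fun _ => 1 / 2) + x) ∘ (Matrix.toLin' M) ∘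
      MeasurableEquiv.finTwoArrow.symm := by
    funext p; ext i
    fin_cases i <;> simp [M] <;> ring
  have hm : Measurable (Matrix.toLin' M) :=
    (LinearMap.continuous_of_finiteDimensional _).measurable
  rw [h3, ← Measure.map_map (by fun_prop) (by fun_prop), ← Measure.map_map hm (by fun_prop), h2,
    h1, Measure.map_smul, (measurePreserving_add_left volume _).map_eq, hM]
  norm_num

lemma measurableEmbedding_toPlane : MeasurableEmbedding toPlane :=
  planeHomeo.measurableEmbedding

lemma integral_toPlane (F : (Fin 2 → ℝ) → ℝ) : ∫ p, F (toPlane p) = 2 * ∫ x, F x := by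
  rw [← measurableEmbedding_toPlane.integral_map, map_toPlane_volume, integral_smul_measure]
  simp

lemma ae_toPlane_iff {P : (Fin 2 → ℝ) → Prop} :
    (∀ᵐ p : ℝ × ℝ, P (toPlane p)) ↔ ∀ᵐ x, P x := by
  rw [← measurableEmbedding_toPlane.ae_map_iff, map_toPlane_volume,
    Measure.ae_ennreal_smul_measure_iff (by norm_num)]

lemma integrable_toPlane_iff {F : (Fin 2 → ℝ) → ℝ} :
    Integrable (fun p => F (toPlane p)) ↔ Integrable F := by
  have := MeasurableEmbedding.integrable_map_iff measurableEmbedding_toPlane (μ := volume) (g := F)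
  rw [map_toPlane_volume, integrable_smul_measure (by norm_num) (by norm_num)] at this
  exact this.symm

lemma crysNorm_eq_max (v : Fin 2 → ℝ) : crysNorm v = max |v 0 + v 1| |v 0 - v 1| := by
  unfold crysNorm
  rcases abs_cases (v 0) with h | h <;> rcases abs_cases (v 1) with h' | h' <;>
  rcases abs_cases (v 0 + v 1) with h1 | h1 <;> rcases abs_cases (v 0 - v 1) with h2 | h2 <;>
  rcases max_cases |v 0 + v 1| |v 0 - v 1| with h3 | h3 <;> linarith

lemma fderiv_comp_ofPlane {a : ℝ × ℝ → ℝ} (ha : Differentiable ℝ a) (x v : Fin 2 → ℝ) :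
    fderiv ℝ (fun y => a (ofPlane y)) x v = fderiv ℝ a (ofPlane x) (v 0 + v 1, v 0 - v 1) := by
  let π (i : Fin 2) : (Fin 2 → ℝ) →L[ℝ] ℝ := ContinuousLinearMap.proj i
  have h : HasFDerivAt ofPlane ((π 0 + π 1).prod (π 0 - π 1)) x := by
    refine HasFDerivAt.prodMk ?_ ?_
    · exact ((hasFDerivAt_apply (𝕜 := ℝ) (0 : Fin 2) x).add (hasFDerivAt_apply 1 x)).sub_const 1
    · exact (hasFDerivAt_apply (𝕜 := ℝ) (0 : Fin 2) x).sub (hasFDerivAt_apply 1 x)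
  have h2 := ((ha (ofPlane x)).hasFDerivAt).comp x h
  have h3 : fderiv ℝ (fun y => a (ofPlane y)) x = _ := h2.fderiv
  rw [h3]; rfl

lemma contDiff_ofPlane : ContDiff ℝ 1 ofPlane := by
  unfold ofPlane; fun_prop

/-- The divergence in rotated coordinates. -/
lemma diverg_rotated {a b : ℝ × ℝ → ℝ} (ha : ContDiff ℝ 1 a) (hb : ContDiff ℝ 1 b)
    (x : Fin 2 → ℝ) :
    diverg (fun y => ![(a (ofPlane y) + b (ofPlane y)) / 2, (a (ofPlane y) - b (ofPlane y)) / 2]) x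
      = fderiv ℝ a (ofPlane x) (1, 0) + fderiv ℝ b (ofPlane x) (0, 1) := by
  have ha' := ha.differentiable one_ne_zero
  have hb' := hb.differentiable one_ne_zero
  have hA : Differentiable ℝ fun y => a (ofPlane y) :=
    ha'.comp (contDiff_ofPlane.differentiable one_ne_zero)
  have hB : Differentiable ℝ fun y => b (ofPlane y) :=
    hb'.comp (contDiff_ofPlane.differentiable one_ne_zero)
  have hd : HasFDerivAt
      (fun y => ![(a (ofPlane y) + b (ofPlane y)) / 2, (a (ofPlane y) - b (ofPlane y)) / 2])
      (ContinuousLinearMap.pi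
        ![(2⁻¹ : ℝ) • (fderiv ℝ (fun y => a (ofPlane y)) x + fderiv ℝ (fun y => b (ofPlane y)) x),
          (2⁻¹ : ℝ) • (fderiv ℝ (fun y => a (ofPlane y)) x
            - fderiv ℝ (fun y => b (ofPlane y)) x)]) x := by
    rw [hasFDerivAt_pi']
    intro i
    fin_cases i
    · convert ((hA x).hasFDerivAt.add (hB x).hasFDerivAt).const_smul (2⁻¹ : ℝ) using 1
      · ext y; simp; ring
      · rfl
    · convert ((hA x).hasFDerivAt.sub (hB x).hasFDerivAt).const_smul (2⁻¹ : ℝ) using 1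
      · ext y; simp; ring
      · rfl
  have e1 : ((1 : ℝ), (1 : ℝ)) = (1, 0) + (0, 1) := by simp
  have e2 : ((1 : ℝ), (-1 : ℝ)) = (1, 0) - (0, 1) := by simp
  simp [diverg, hd.fderiv, Fin.sum_univ_two, fderiv_comp_ofPlane ha', fderiv_comp_ofPlane hb']
  rw [e1, e2]
  simp only [map_add, map_sub]
  ring

lemma ofReal_le_anisoTV {u : (Fin 2 → ℝ) → ℝ} {a b : ℝ × ℝ → ℝ} (ha : ContDiff ℝ 1 a)
    (hb : ContDiff ℝ 1 b) (hac : HasCompactSupport a) (hbc : HasCompactSupport b)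
    (ha1 : ∀ p, |a p| ≤ 1) (hb1 : ∀ p, |b p| ≤ 1) :
    ENNReal.ofReal ((∫ p, u (toPlane p) * (fderiv ℝ a p (1, 0) + fderiv ℝ b p (0, 1))) / 2)
      ≤ anisoTV crysNorm u := by
  set η : (Fin 2 → ℝ) → (Fin 2 → ℝ) := fun y =>
    ![(a (ofPlane y) + b (ofPlane y)) / 2, (a (ofPlane y) - b (ofPlane y)) / 2] with hη
  have hA : ContDiff ℝ 1 fun y => a (ofPlane y) := ha.comp contDiff_ofPlane
  have hB : ContDiff ℝ 1 fun y => b (ofPlane y) := hb.comp contDiff_ofPlane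
  have hAc : HasCompactSupport fun y => a (ofPlane y) := hac.comp_homeomorph planeHomeo.symm
  have hBc : HasCompactSupport fun y => b (ofPlane y) := hbc.comp_homeomorph planeHomeo.symm
  have h1 : ContDiff ℝ 1 η := by
    rw [contDiff_pi]
    intro i
    fin_cases i
    · exact (hA.add hB).div_const 2
    · exact (hA.sub hB).div_const 2
  have h2 : HasCompactSupport η := by
    refine HasCompactSupport.intro (hAc.isCompact.union hBc.isCompact) fun x hx => ?_
    rw [mem_union, not_or] at hx
    have e1 := image_eq_zero_of_notMem_tsupport hx.1
    have e2 := image_eq_zero_of_notMem_tsupport hx.2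
    ext i
    fin_cases i <;> simp_all
  have h3 : ∀ x, crysNorm (η x) ≤ 1 := by
    intro x
    rw [crysNorm_eq_max]
    simp only [hη, Matrix.cons_val_zero, Matrix.cons_val_one]
    refine max_le ?_ ?_
    · have := ha1 (ofPlane x); rwa [← add_div, add_add_sub_cancel, add_self_div_two]
    · have := hb1 (ofPlane x); rwa [← sub_div, add_sub_sub_cancel, add_self_div_two]
  have h4 : (∫ p, u (toPlane p) * (fderiv ℝ a p (1, 0) + fderiv ℝ b p (0, 1))) / 2
      = ∫ x, u x * diverg η x := by
    rw [div_eq_iff two_ne_zero, mul_comm _ (2 : ℝ), ← integral_toPlane]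
    simp only [hη, diverg_rotated ha hb, ofPlane_toPlane]
  rw [h4]
  exact le_iSup₂_of_le η ⟨h1, h2, h3⟩ le_rfl

/-- A bounded, boundedly supported density on the plane whose vertical slices have total mass `0`
and primitives bounded by `1`: the vertical derivative of a Lipschitz test function. -/
structure IsFlux (κ : ℝ × ℝ → ℝ) : Prop where
  measurable : Measurable κ
  bounded : ∃ C, ∀ p, |κ p| ≤ C
  support : ∀ p, κ p ≠ 0 → p ∈ Icc (-3 : ℝ) 3 ×ˢ Icc (-3 : ℝ) 3
  prim : ∀ x y, |∫ z in Iic y, κ (x, z)| ≤ 1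
  total : ∀ x, ∫ z, κ (x, z) = 0

/-- The primitive of `κ` along vertical lines. -/
def vertPrim (κ : ℝ × ℝ → ℝ) (p : ℝ × ℝ) : ℝ := ∫ z in Iic p.2, κ (p.1, z)

lemma integrable_of_bounded_support {α : Type*} [MeasurableSpace α] {μ : Measure α} {f : α → ℝ}
    {s : Set α} {C : ℝ} (hf : Measurable f) (hs : MeasurableSet s) (hμ : μ s ≠ ⊤)
    (hC : ∀ x, |f x| ≤ C)
    (hfs : ∀ x, f x ≠ 0 → x ∈ s) : Integrable f μ := by
  have h : IntegrableOn f s μ :=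
    Measure.integrableOn_of_bounded (M := C) hμ hf.aestronglyMeasurable (ae_of_all _ hC)
  rw [← integrable_indicator_iff hs, indicator_eq_self.2 fun x hx => hfs x hx] at h
  exact h

namespace IsFlux

variable {κ : ℝ × ℝ → ℝ}

lemma integrable (h : IsFlux κ) : Integrable κ := by
  obtain ⟨C, hC⟩ := h.bounded
  exact integrable_of_bounded_support h.measurable (measurableSet_Icc.prod measurableSet_Icc)
    (isCompact_Icc.prod isCompact_Icc).measure_lt_top.ne hC h.support

lemma integrable_slice (h : IsFlux κ) (x : ℝ) : Integrable fun z => κ (x, z) := by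
  obtain ⟨C, hC⟩ := h.bounded
  exact integrable_of_bounded_support (h.measurable.comp measurable_prodMk_left) measurableSet_Icc
    (isCompact_Icc (a := (-3 : ℝ)) (b := 3)).measure_lt_top.ne (fun z => hC _)
    fun z hz => (h.support _ hz).2

lemma vertPrim_eq_zero (h : IsFlux κ) {p : ℝ × ℝ} (hp : p ∉ Icc (-3 : ℝ) 3 ×ˢ Icc (-3 : ℝ) 3) :
    vertPrim κ p = 0 := by
  unfold vertPrim
  by_cases h1 : p.1 ∈ Icc (-3 : ℝ) 3
  · by_cases h2 : p.2 < -3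
    · refine setIntegral_eq_zero_of_forall_eq_zero fun z hz => ?_
      by_contra hne
      have := (h.support _ hne).2.1
      simp only [mem_Iic] at hz this
      linarith
    · have h3 : 3 < p.2 := by
        by_contra h3
        exact hp ⟨h1, not_lt.1 h2, not_lt.1 h3⟩
      rw [setIntegral_eq_integral_of_forall_compl_eq_zero, h.total]
      intro z hz
      by_contra hne
      have := (h.support _ hne).2.2
      simp only [mem_Iic, not_le] at hz this
      linarith
  · refine setIntegral_eq_zero_of_forall_eq_zero fun z _ => ?_
    by_contra hne
    exact h1 (h.support _ hne).1

lemma measurable_vertPrim (h : IsFlux κ) : Measurable (vertPrim κ) := by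
  have h1 : vertPrim κ = fun p : ℝ × ℝ => ∫ z, indicator {q : (ℝ × ℝ) × ℝ | q.2 ≤ q.1.2}
      (fun q => κ (q.1.1, q.2)) (p, z) := by
    funext p
    unfold vertPrim
    rw [← integral_indicator measurableSet_Iic]
    rfl
  rw [h1]
  refine (StronglyMeasurable.integral_prod_right' ?_).measurable
  refine (Measurable.indicator ?_ ?_).stronglyMeasurable
  · exact h.measurable.comp (by fun_prop)
  · exact measurableSet_le (by fun_prop) (by fun_prop)

lemma hasCompactSupport_vertPrim (h : IsFlux κ) : HasCompactSupport (vertPrim κ) :=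
  HasCompactSupport.intro (isCompact_Icc.prod isCompact_Icc) fun _ hp => h.vertPrim_eq_zero hp

lemma integrable_vertPrim (h : IsFlux κ) : Integrable (vertPrim κ) :=
  integrable_of_bounded_support h.measurable_vertPrim (measurableSet_Icc.prod measurableSet_Icc)
    (isCompact_Icc.prod isCompact_Icc).measure_lt_top.ne (fun p => h.prim p.1 p.2)
    fun _ hp => by_contra fun h' => hp (h.vertPrim_eq_zero h')

end IsFlux

/-- Convolution with a normalised bump function. -/
def mollify (ρ : ContDiffBump (0 : ℝ × ℝ)) (g : ℝ × ℝ → ℝ) : ℝ × ℝ → ℝ :=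
  convolution (ρ.normed volume) g (ContinuousLinearMap.lsmul ℝ ℝ) volume

lemma mollify_apply (ρ : ContDiffBump (0 : ℝ × ℝ)) (g : ℝ × ℝ → ℝ) (p : ℝ × ℝ) :
    mollify ρ g p = ∫ q, ρ.normed volume q * g (p - q) := rfl

lemma abs_mollify_le (ρ : ContDiffBump (0 : ℝ × ℝ)) {g : ℝ × ℝ → ℝ} (hg : Measurable g) {C : ℝ}
    (hC : ∀ p, |g p| ≤ C) (p : ℝ × ℝ) : |mollify ρ g p| ≤ C := by
  have hC0 : 0 ≤ C := (abs_nonneg _).trans (hC 0)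
  have := dist_convolution_le (μ := (volume : Measure (ℝ × ℝ))) (x₀ := p) (z₀ := (0 : ℝ)) hC0
    ρ.support_normed_eq.subset
    ρ.nonneg_normed ρ.integral_normed hg.aestronglyMeasurable
    (fun x _ => by simpa using hC x)
  simpa [mollify] using this

lemma continuous_mollify (ρ : ContDiffBump (0 : ℝ × ℝ)) {g : ℝ × ℝ → ℝ} (hg : Integrable g) :
    Continuous (mollify ρ g) :=
  HasCompactSupport.continuous_convolution_left _ ρ.hasCompactSupport_normed ρ.continuous_normed
    hg.locallyIntegrable

lemma contDiff_mollify (ρ : ContDiffBump (0 : ℝ × ℝ)) {g : ℝ × ℝ → ℝ} (hg : Integrable g) :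
    ContDiff ℝ 1 (mollify ρ g) :=
  HasCompactSupport.contDiff_convolution_left (n := 1) _ ρ.hasCompactSupport_normed
    ρ.contDiff_normed hg.locallyIntegrable

lemma hasCompactSupport_mollify (ρ : ContDiffBump (0 : ℝ × ℝ)) {g : ℝ × ℝ → ℝ}
    (hg : HasCompactSupport g) : HasCompactSupport (mollify ρ g) :=
  HasCompactSupport.convolution _ ρ.hasCompactSupport_normed hg

namespace IsFlux

variable {κ : ℝ × ℝ → ℝ}

lemma mollify_vertPrim_sub (h : IsFlux κ) (ρ : ContDiffBump (0 : ℝ × ℝ)) (x a b : ℝ) :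
    mollify ρ (vertPrim κ) (x, b) - mollify ρ (vertPrim κ) (x, a)
      = ∫ z in a..b, mollify ρ κ (x, z) := by
  obtain ⟨C, hC⟩ := h.bounded
  have hρ : Integrable (ρ.normed volume) := ρ.integrable_normed
  have h_int : ∀ y, Integrable fun q => ρ.normed volume q * vertPrim κ ((x, y) - q) := fun y => by
    refine hρ.mul_bdd (c := 1) ?_ (ae_of_all _ fun q => h.prim _ _)
    exact (h.measurable_vertPrim.comp (by fun_prop)).aestronglyMeasurable
  simp only [mollify_apply]
  rw [← integral_sub (h_int b) (h_int a), intervalIntegral_integral_swap]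
  · refine integral_congr_ae (ae_of_all _ fun q => ?_)
    simp only [intervalIntegral.integral_const_mul, ← mul_sub]
    congr 1
    have h1 : ∀ z, (x, z) - q = (x - q.1, z - q.2) := fun z => rfl
    simp only [h1, vertPrim]
    rw [intervalIntegral.integral_Iic_sub_Iic (h.integrable_slice _).integrableOn
      (h.integrable_slice _).integrableOn,
      intervalIntegral.integral_comp_sub_right (fun w => κ (x - q.1, w))]
  · have h2 : Integrable (fun w : ℝ × ℝ × ℝ => (1 : ℝ) * ρ.normed volume w.2)
        ((volume.restrict (uIoc a b)).prod volume) := by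
      refine Integrable.mul_prod (f := fun _ : ℝ => (1 : ℝ)) ?_ hρ
      exact integrable_const_iff.2 (Or.inr ⟨by simp [uIoc, Real.volume_Ioc]⟩)
    simp only [one_mul] at h2
    refine h2.mul_bdd (c := C) ?_ (ae_of_all _ fun q => hC _)
    have h3 : Measurable fun w : ℝ × ℝ × ℝ => κ ((x, w.1) - w.2) := h.measurable.comp (by fun_prop)
    exact h3.aestronglyMeasurable

lemma fderiv_mollify_vertPrim (h : IsFlux κ) (ρ : ContDiffBump (0 : ℝ × ℝ)) (p : ℝ × ℝ) :
    fderiv ℝ (mollify ρ (vertPrim κ)) p (0, 1) = mollify ρ κ p := by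
  have hc := continuous_mollify ρ h.integrable
  have hd := (contDiff_mollify ρ h.integrable_vertPrim).differentiable one_ne_zero
  have hc' : Continuous fun z => mollify ρ κ (p.1, z) := by fun_prop
  have h1 : HasDerivAt (fun y => mollify ρ (vertPrim κ) (p.1, y)) (mollify ρ κ p) p.2 := by
    have h2 := (intervalIntegral.integral_hasDerivAt_right (hc'.intervalIntegrable 0 p.2)
      hc'.aestronglyMeasurable.stronglyMeasurableAtFilter hc'.continuousAt).const_add
      (mollify ρ (vertPrim κ) (p.1, 0))
    refine h2.congr_of_eventuallyEq (Eventually.of_forall fun y => ?_)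
    simp only
    rw [← h.mollify_vertPrim_sub]; ring
  have h3 : HasDerivAt (fun y => mollify ρ (vertPrim κ) (p.1, y))
      (fderiv ℝ (mollify ρ (vertPrim κ)) p (0, 1)) p.2 := by
    have h4 : HasDerivAt (fun y : ℝ => (p.1, y)) ((0 : ℝ), (1 : ℝ)) p.2 :=
      (hasDerivAt_const _ _).prodMk (hasDerivAt_id _)
    exact HasFDerivAt.comp_hasDerivAt p.2 (hd p).hasFDerivAt h4
  exact h3.unique h1

end IsFlux

/-- `C` bounds the total variation of `f` computed along vertical and horizontal lines. -/
def FluxBound (f : ℝ × ℝ → ℝ) (C : ℝ) : Prop :=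
  ∀ κ γ, IsFlux κ → IsFlux γ → (∫ p, f p * κ p) + (∫ p, f p.swap * γ p) ≤ 2 * C

lemma FluxBound.swap {f : ℝ × ℝ → ℝ} {C : ℝ} (h : FluxBound f C) :
    FluxBound (fun p => f p.swap) C := fun κ γ hκ hγ => by
  simpa [add_comm] using h γ κ hγ hκ

lemma tendsto_integral_mul_mollify {f κ : ℝ × ℝ → ℝ} (hf : Integrable f) (h : IsFlux κ)
    {ρ : ℕ → ContDiffBump (0 : ℝ × ℝ)} (hρ : Tendsto (fun n => (ρ n).rOut) atTop (nhds 0))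
    (hρ' : ∀ n, (ρ n).rOut ≤ 2 * (ρ n).rIn) :
    Tendsto (fun n => ∫ p, f p * mollify (ρ n) κ p) atTop (nhds (∫ p, f p * κ p)) := by
  obtain ⟨C, hC⟩ := h.bounded
  refine tendsto_integral_of_dominated_convergence (fun p => |f p| * C) (fun n => ?_)
    (hf.abs.mul_const C) (fun n => ae_of_all _ fun p => ?_) ?_
  · exact hf.aestronglyMeasurable.mul (continuous_mollify _ h.integrable).aestronglyMeasurable
  · rw [norm_mul]
    exact mul_le_mul_of_nonneg_left (abs_mollify_le _ h.measurable hC _) (abs_nonneg _)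
  · filter_upwards [ContDiffBump.ae_convolution_tendsto_right_of_locallyIntegrable hρ
      (Eventually.of_forall hρ') h.integrable.locallyIntegrable] with p hp
    exact hp.const_mul _

lemma fluxBound_of_anisoTV {u : (Fin 2 → ℝ) → ℝ} (hu : Integrable u)
    (hTV : anisoTV crysNorm u ≠ ⊤) :
    FluxBound (fun p => u (toPlane p)) (anisoTV crysNorm u).toReal := by
  intro κ γ hκ hγ
  let ρ : ℕ → ContDiffBump (0 : ℝ × ℝ) := fun n =>
    { rIn := 1 / (n + 1), rOut := 2 * (1 / (n + 1)), rIn_pos := by positivity,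
      rIn_lt_rOut := by have : (0 : ℝ) < 1 / (n + 1) := by positivity
                        linarith }
  have hρ : Tendsto (fun n => (ρ n).rOut) atTop (nhds 0) := by
    have := (tendsto_one_div_add_atTop_nhds_zero_nat (𝕜 := ℝ)).const_mul 2
    rwa [mul_zero] at this
  have hf : Integrable fun p => u (toPlane p) := integrable_toPlane_iff.2 hu
  have hf' : Integrable fun p : ℝ × ℝ => u (toPlane p.swap) := hf.swap
  have hlim := (tendsto_integral_mul_mollify hf hκ hρ fun n => le_rfl).add
    (tendsto_integral_mul_mollify hf' hγ hρ fun n => le_rfl)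
  refine le_of_tendsto hlim (Eventually.of_forall fun n => ?_)
  have hswap : ContDiff ℝ 1 (Prod.swap : ℝ × ℝ → ℝ × ℝ) := contDiff_snd.prodMk contDiff_fst
  set a : ℝ × ℝ → ℝ := fun p => mollify (ρ n) (vertPrim γ) p.swap with ha
  have hb := contDiff_mollify (ρ n) hκ.integrable_vertPrim
  have hg := contDiff_mollify (ρ n) hγ.integrable_vertPrim
  have hfd : ∀ p, fderiv ℝ a p (1, 0) = mollify (ρ n) γ p.swap := by
    intro p
    rw [← hγ.fderiv_mollify_vertPrim]
    have h1 : HasFDerivAt (Prod.swap : ℝ × ℝ → ℝ × ℝ)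
        ((ContinuousLinearMap.snd ℝ ℝ ℝ).prod (ContinuousLinearMap.fst ℝ ℝ ℝ)) p :=
      HasFDerivAt.prodMk hasFDerivAt_snd hasFDerivAt_fst
    have h2 : fderiv ℝ a p = _ :=
      (((hg.differentiable one_ne_zero) p.swap).hasFDerivAt.comp p h1).fderiv
    rw [h2]; rfl
  have key := ofReal_le_anisoTV (u := u) (a := a) (hg.comp hswap) hb
    ((hasCompactSupport_mollify (ρ n) hγ.hasCompactSupport_vertPrim).comp_homeomorph
      (Homeomorph.prodComm ℝ ℝ))
    (hasCompactSupport_mollify (ρ n) hκ.hasCompactSupport_vertPrim)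
    (fun p => abs_mollify_le _ hγ.measurable_vertPrim (fun q => hγ.prim _ _) _)
    (fun p => abs_mollify_le _ hκ.measurable_vertPrim (fun q => hκ.prim _ _) _)
  rw [ENNReal.ofReal_le_iff_le_toReal hTV, div_le_iff₀ two_pos] at key
  simp only [hfd, hκ.fderiv_mollify_vertPrim, mul_add] at key
  have hbd : ∀ {g : ℝ × ℝ → ℝ} {k : ℝ × ℝ → ℝ}, Integrable g → IsFlux k →
      Integrable fun p => g p * mollify (ρ n) k p := fun hg hk => by
    obtain ⟨C, hC⟩ := hk.bounded
    exact hg.mul_bdd (c := C) (continuous_mollify _ hk.integrable).aestronglyMeasurable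
      (ae_of_all _ fun p => abs_mollify_le _ hk.measurable hC _)
  have h2 := (hbd hf' hγ).swap
  simp only [Function.comp_def, Prod.swap_swap] at h2
  rw [← Measure.volume_eq_prod] at h2
  rw [integral_add h2 (hbd hf hκ)] at key
  have h3 := integral_prod_swap (μ := (volume : Measure ℝ)) (ν := (volume : Measure ℝ))
    (fun p : ℝ × ℝ => u (toPlane p) * mollify (ρ n) γ p.swap)
  simp only [Prod.swap_swap] at h3
  rw [← Measure.volume_eq_prod] at h3
  rw [h3]
  linarith

/-- The unit square in rotated coordinates. -/
def diamond : Set (ℝ × ℝ) := {p | |p.1| + |p.2| < 1}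

/-- The part of the diamond inside a centred square of half-side `c`. -/
def octagon (c : ℝ) : Set (ℝ × ℝ) := {p | |p.1| < c ∧ |p.2| < c ∧ |p.1| + |p.2| < 1}

lemma isOpen_diamond : IsOpen diamond := isOpen_lt (by fun_prop) (by fun_prop)

lemma isOpen_octagon (c : ℝ) : IsOpen (octagon c) := by
  have h : octagon c = {p | |p.1| < c} ∩ ({p | |p.2| < c} ∩ {p | |p.1| + |p.2| < 1}) := by
    ext p; simp [octagon]
  rw [h]
  exact (isOpen_lt (by fun_prop) (by fun_prop)).inter
    ((isOpen_lt (by fun_prop) (by fun_prop)).inter (isOpen_lt (by fun_prop) (by fun_prop)))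

lemma octagon_subset_diamond (c : ℝ) : octagon c ⊆ diamond := fun _ hp => hp.2.2

lemma octagon_one : octagon 1 = diamond := by
  ext p
  simp only [octagon, diamond, mem_ofPred_eq]
  constructor
  · exact fun h => h.2.2
  · intro h
    have := abs_nonneg p.1
    have := abs_nonneg p.2
    exact ⟨by linarith, by linarith, h⟩

lemma mem_octagon_iff {c : ℝ} {p : ℝ × ℝ} :
    p ∈ octagon c ↔ p.1 ∈ Ioo (-c) c ∧ p.2 ∈ Ioo (-(min c (1 - |p.1|))) (min c (1 - |p.1|)) := by
  rw [mem_Ioo, mem_Ioo, ← abs_lt, ← abs_lt, lt_min_iff]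
  constructor
  · rintro ⟨h1, h2, h3⟩; exact ⟨h1, h2, by linarith⟩
  · rintro ⟨h1, h2, h3⟩; exact ⟨h1, h2, by linarith⟩

lemma swap_mem_octagon {c : ℝ} {p : ℝ × ℝ} : p.swap ∈ octagon c ↔ p ∈ octagon c := by
  simp only [octagon, mem_ofPred_eq, Prod.fst_swap, Prod.snd_swap]
  rw [add_comm]; tauto

lemma diamond_subset_box : diamond ⊆ Icc (-1 : ℝ) 1 ×ˢ Icc (-1 : ℝ) 1 := by
  intro p hp
  have hp : |p.1| + |p.2| < 1 := hp
  have h1 := abs_nonneg p.1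
  have h2 := abs_nonneg p.2
  exact ⟨abs_le.1 (by linarith), abs_le.1 (by linarith)⟩

lemma volume_diamond_ne_top : volume diamond ≠ ⊤ :=
  ((measure_mono diamond_subset_box).trans_lt
    (isCompact_Icc.prod isCompact_Icc).measure_lt_top).ne

lemma setIntegral_octagon_swap (c : ℝ) (f : ℝ × ℝ → ℝ) :
    ∫ p in octagon c, f p.swap = ∫ p in octagon c, f p := by
  rw [← integral_indicator (isOpen_octagon c).measurableSet,
    ← integral_indicator (isOpen_octagon c).measurableSet]
  have h := integral_prod_swap (μ := (volume : Measure ℝ)) (ν := (volume : Measure ℝ))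
    (indicator (octagon c) f)
  rw [← Measure.volume_eq_prod] at h
  rw [← h]
  congr 1
  funext p
  by_cases hp : p ∈ octagon c
  · rw [indicator_of_mem hp, indicator_of_mem (swap_mem_octagon.2 hp)]
  · rw [indicator_of_notMem hp, indicator_of_notMem (mt swap_mem_octagon.1 hp)]

lemma setIntegral_octagon_fderiv_le {b : ℝ × ℝ → ℝ} (hb : ContDiff ℝ 1 b) (hb1 : ∀ p, |b p| ≤ 1)
    {c : ℝ} (hc : 0 < c) (hc1 : c ≤ 1) :
    ∫ p in octagon c, fderiv ℝ b p (0, 1) ≤ 4 * c := by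
  have hcont : Continuous fun p => fderiv ℝ b p (0, 1) :=
    (hb.continuous_fderiv one_ne_zero).clm_apply continuous_const
  have h_int : IntegrableOn (fun p => fderiv ℝ b p (0, 1)) (octagon c) :=
    (hcont.continuousOn.integrableOn_compact (isCompact_Icc.prod isCompact_Icc)).mono_set
      ((octagon_subset_diamond c).trans diamond_subset_box)
  have h_int' := (integrable_indicator_iff (isOpen_octagon c).measurableSet).2 h_int
  rw [← integral_indicator (isOpen_octagon c).measurableSet]
  rw [Measure.volume_eq_prod] at h_int' ⊢
  rw [integral_prod _ h_int']
  have hI : Integrable ((Ioo (-c) c).indicator fun _ => (2 : ℝ)) :=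
    (integrable_indicator_iff measurableSet_Ioo).2 (integrableOn_const (by simp))
  calc _ ≤ ∫ x, (Ioo (-c) c).indicator (fun _ => (2 : ℝ)) x := by
        refine integral_mono h_int'.integral_prod_left hI fun x => ?_
        by_cases hx : x ∈ Ioo (-c) c
        · have hx' : |x| < c := abs_lt.2 hx
          set g := min c (1 - |x|) with hg
          have hg0 : 0 < g := lt_min hc (by linarith)
          have h1 : (fun y => (octagon c).indicator (fun p => fderiv ℝ b p (0, 1)) (x, y))
              = (Ioo (-g) g).indicator fun y => fderiv ℝ b (x, y) (0, 1) := by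
            funext y
            simp only [indicator, mem_octagon_iff, hx, true_and, ← hg]
          have hd : ∀ y : ℝ, HasDerivAt (fun y => b (x, y)) (fderiv ℝ b (x, y) (0, 1)) y := by
            intro y
            have h4 : HasDerivAt (fun y : ℝ => (x, y)) ((0 : ℝ), (1 : ℝ)) y :=
              (hasDerivAt_const _ _).prodMk (hasDerivAt_id _)
            exact HasFDerivAt.comp_hasDerivAt y
              ((hb.differentiable one_ne_zero) (x, y)).hasFDerivAt h4
          simp only [h1]
          rw [integral_indicator measurableSet_Ioo, ← integral_Ioc_eq_integral_Ioo,
            ← intervalIntegral.integral_of_le (by linarith),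
            intervalIntegral.integral_eq_sub_of_hasDerivAt (fun y _ => hd y)
              ((hcont.comp (by fun_prop : Continuous fun y : ℝ => (x, y))).intervalIntegrable _ _)]
          rw [indicator_of_mem hx]
          have e1 := abs_le.1 (hb1 (x, g))
          have e2 := abs_le.1 (hb1 (x, -g))
          linarith
        · have h1 : (fun y => (octagon c).indicator (fun p => fderiv ℝ b p (0, 1)) (x, y))
              = fun _ => 0 := by
            funext y
            simp only [indicator, mem_octagon_iff, hx, false_and, if_false]
          simp [h1, hx]
    _ = 4 * c := by
        rw [integral_indicator measurableSet_Ioo, setIntegral_const]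
        simp [Measure.real, hc.le]
        ring

lemma anisoTV_octagon_le {c : ℝ} (hc : 0 < c) (hc1 : c ≤ 1) :
    anisoTV crysNorm ((ofPlane ⁻¹' octagon c).indicator 1) ≤ ENNReal.ofReal (4 * c) := by
  refine iSup₂_le fun η hη => ENNReal.ofReal_le_ofReal ?_
  obtain ⟨h1, -, h3⟩ := hη
  have hcT : ContDiff ℝ 1 toPlane := by
    rw [contDiff_pi]
    intro i
    fin_cases i <;> simp <;> fun_prop
  have hη0 : ∀ i, ContDiff ℝ 1 fun p => η (toPlane p) i := fun i =>
    (contDiff_pi.1 (h1.comp hcT)) i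
  set a : ℝ × ℝ → ℝ := fun p => η (toPlane p) 0 + η (toPlane p) 1 with ha
  set b : ℝ × ℝ → ℝ := fun p => η (toPlane p) 0 - η (toPlane p) 1 with hb
  have hac : ContDiff ℝ 1 a := (hη0 0).add (hη0 1)
  have hbc : ContDiff ℝ 1 b := (hη0 0).sub (hη0 1)
  have hab : ∀ p, |a p| ≤ 1 ∧ |b p| ≤ 1 := fun p => by
    have := h3 (toPlane p)
    rw [crysNorm_eq_max] at this
    exact max_le_iff.1 this
  have hηe : η = fun y =>
      ![(a (ofPlane y) + b (ofPlane y)) / 2, (a (ofPlane y) - b (ofPlane y)) / 2] := by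
    funext y; ext i
    fin_cases i <;> simp [ha, hb]
  have hdiv : ∀ p, diverg η (toPlane p) = fderiv ℝ a p (1, 0) + fderiv ℝ b p (0, 1) := by
    intro p
    rw [hηe, diverg_rotated hac hbc, ofPlane_toPlane]
  have hai : Continuous fun p => fderiv ℝ a p (1, 0) :=
    (hac.continuous_fderiv one_ne_zero).clm_apply continuous_const
  have hbi : Continuous fun p => fderiv ℝ b p (0, 1) :=
    (hbc.continuous_fderiv one_ne_zero).clm_apply continuous_const
  have h_int : ∀ {f : ℝ × ℝ → ℝ}, Continuous f → IntegrableOn f (octagon c) := fun hf =>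
    (hf.continuousOn.integrableOn_compact (isCompact_Icc.prod isCompact_Icc)).mono_set
      ((octagon_subset_diamond c).trans diamond_subset_box)
  have hkey : 2 * (∫ x, (ofPlane ⁻¹' octagon c).indicator 1 x * diverg η x)
      = (∫ p in octagon c, fderiv ℝ a p (1, 0)) + ∫ p in octagon c, fderiv ℝ b p (0, 1) := by
    rw [← integral_toPlane, ← integral_add (h_int hai) (h_int hbi),
      ← integral_indicator (isOpen_octagon c).measurableSet]
    congr 1
    funext p
    by_cases hp : p ∈ octagon c <;> simp [indicator, hp, hdiv]
  have hswap : ContDiff ℝ 1 (Prod.swap : ℝ × ℝ → ℝ × ℝ) := contDiff_snd.prodMk contDiff_fst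
  have h4 := setIntegral_octagon_fderiv_le hbc (fun p => (hab p).2) hc hc1
  have h5 := setIntegral_octagon_fderiv_le (hac.comp hswap) (fun p => (hab p.swap).1) hc hc1
  have hfd : ∀ p, fderiv ℝ (a ∘ Prod.swap) p (0, 1) = fderiv ℝ a p.swap (1, 0) := by
    intro p
    have h1 : HasFDerivAt (Prod.swap : ℝ × ℝ → ℝ × ℝ)
        ((ContinuousLinearMap.snd ℝ ℝ ℝ).prod (ContinuousLinearMap.fst ℝ ℝ ℝ)) p :=
      HasFDerivAt.prodMk hasFDerivAt_snd hasFDerivAt_fst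
    have h2 := (((hac.differentiable one_ne_zero) p.swap).hasFDerivAt.comp p h1).fderiv
    rw [h2]; rfl
  simp only [hfd] at h5
  rw [setIntegral_octagon_swap c fun p => fderiv ℝ a p (1, 0)] at h5
  linarith

lemma intervalIntegral_min_eq {a b : ℝ} (hb : b ≤ 1) (hab : 1 ≤ a + b) :
    ∫ x in -a..a, 2 * min b (1 - |x|) = 2 - 2 * (1 - a) ^ 2 - 2 * (1 - b) ^ 2 := by
  have hI : ∀ s t : ℝ, IntervalIntegrable (fun x : ℝ => 2 * min b (1 - |x|)) volume s t :=
    fun s t => (by fun_prop : Continuous fun x : ℝ => 2 * min b (1 - |x|)).intervalIntegrable _ _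
  rw [← intervalIntegral.integral_add_adjacent_intervals (hI (-a) (-(1 - b))) (hI _ a),
    ← intervalIntegral.integral_add_adjacent_intervals (hI (-(1 - b)) (1 - b)) (hI _ a)]
  have e1 : ∫ x in -a..-(1 - b), 2 * min b (1 - |x|) = ∫ x in -a..-(1 - b), (2 + 2 * x) := by
    refine intervalIntegral.integral_congr fun x hx => ?_
    rw [uIcc_of_le (by linarith)] at hx
    have h1 : |x| = -x := abs_of_nonpos (by linarith [hx.2])
    simp only [h1]
    rw [min_eq_right (by linarith [hx.2])]; ring
  have e2 : ∫ x in -(1 - b)..(1 - b), 2 * min b (1 - |x|) = ∫ x in -(1 - b)..(1 - b), 2 * b := by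
    refine intervalIntegral.integral_congr fun x hx => ?_
    rw [uIcc_of_le (by linarith)] at hx
    have h1 : |x| ≤ 1 - b := abs_le.2 hx
    show 2 * min _ _ = _
    rw [min_eq_left (by linarith)]
  have e3 : ∫ x in (1 - b)..a, 2 * min b (1 - |x|) = ∫ x in (1 - b)..a, (2 - 2 * x) := by
    refine intervalIntegral.integral_congr fun x hx => ?_
    rw [uIcc_of_le (by linarith)] at hx
    have h1 : |x| = x := abs_of_nonneg (by linarith [hx.1])
    simp only [h1]
    rw [min_eq_right (by linarith [hx.1])]; ring
  rw [e1, e2, e3, intervalIntegral.integral_add (by simp)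
    ((by fun_prop : Continuous fun x : ℝ => 2 * x).intervalIntegrable _ _),
    intervalIntegral.integral_sub (by simp)
    ((by fun_prop : Continuous fun x : ℝ => 2 * x).intervalIntegrable _ _)]
  have e4 : ∀ s t : ℝ, ∫ x in s..t, 2 * x = t ^ 2 - s ^ 2 := fun s t => by
    rw [intervalIntegral.integral_const_mul, integral_id]; ring
  rw [e4, e4]
  simp only [intervalIntegral.integral_const, smul_eq_mul]
  ring

lemma volume_real_octagon {c : ℝ} (hc : 0 < c) (hc1 : c ≤ 1) :
    volume.real (octagon c) = ∫ x in -c..c, 2 * min c (1 - |x|) := by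
  have h1 : octagon c = regionBetween (fun x => -(min c (1 - |x|))) (fun x => min c (1 - |x|))
      (Ioo (-c) c) := by
    ext p; exact mem_octagon_iff
  have hnn : ∀ x ∈ Ioo (-c) c, 0 ≤ min c (1 - |x|) := fun x hx =>
    le_min hc.le (by linarith [abs_lt.2 hx])
  have hI : ∀ {f : ℝ → ℝ}, Continuous f → IntegrableOn f (Ioo (-c) c) := fun hf =>
    (hf.integrableOn_Icc (a := -c) (b := c)).mono_set Ioo_subset_Icc_self
  rw [h1, measureReal_def, Measure.volume_eq_prod,
    volume_regionBetween_eq_integral (hI (by fun_prop)) (hI (by fun_prop)) measurableSet_Ioo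
      fun x hx => by linarith [hnn x hx], ENNReal.toReal_ofReal,
    intervalIntegral.integral_of_le (by linarith), integral_Ioc_eq_integral_Ioo]
  · refine setIntegral_congr_fun measurableSet_Ioo fun x _ => ?_
    simp only [Pi.sub_apply]; ring
  · refine setIntegral_nonneg measurableSet_Ioo fun x hx => ?_
    simp only [Pi.sub_apply]; linarith [hnn x hx]

lemma volume_real_octagon_of_le {c : ℝ} (hc : 0 < c) (hc2 : c ≤ 1 / 2) :
    volume.real (octagon c) = 4 * c ^ 2 := by
  rw [volume_real_octagon hc (by linarith),
    intervalIntegral.integral_congr (g := fun _ => 2 * c), intervalIntegral.integral_const]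
  · simp; ring
  · intro x hx
    rw [uIcc_of_le (by linarith)] at hx
    have h1 : |x| ≤ c := abs_le.2 hx
    show 2 * min _ _ = _
    rw [min_eq_left (by linarith)]

lemma volume_real_octagon_of_ge {c : ℝ} (hc : 1 / 2 ≤ c) (hc1 : c ≤ 1) :
    volume.real (octagon c) = 2 - 4 * (1 - c) ^ 2 := by
  rw [volume_real_octagon (by linarith) hc1, intervalIntegral_min_eq hc1 (by linarith)]
  ring

section shadow

/-- The essential projection of a planar set on the first coordinate axis. -/
def shadow (E : Set (ℝ × ℝ)) : Set ℝ := {x | volume (Prod.mk x ⁻¹' E) ≠ 0}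

variable {E : Set (ℝ × ℝ)}

lemma measurableSet_shadow (hE : MeasurableSet E) : MeasurableSet (shadow E) :=
  measurable_measure_prodMk_left hE (measurableSet_singleton 0).compl

lemma shadow_mono {F : Set (ℝ × ℝ)} (h : E ⊆ F) : shadow E ⊆ shadow F := fun _ hx h0 =>
  hx (measure_mono_null (preimage_mono h) h0)

lemma ae_mem_shadow (hE : MeasurableSet E) : ∀ᵐ p, p ∈ E → p.1 ∈ shadow E := by
  have hm : MeasurableSet {p : ℝ × ℝ | p ∈ E → p.1 ∈ shadow E} := by
    have : {p : ℝ × ℝ | p ∈ E → p.1 ∈ shadow E} = Eᶜ ∪ Prod.fst ⁻¹' shadow E := by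
      ext p; simp [imp_iff_not_or]
    rw [this]
    exact hE.compl.union (measurable_fst (measurableSet_shadow hE))
  rw [Measure.volume_eq_prod, Measure.ae_prod_iff_ae_ae hm]
  refine Eventually.of_forall fun x => ?_
  by_cases hx : x ∈ shadow E
  · simp [hx]
  · have h0 : volume (Prod.mk x ⁻¹' E) = 0 := by simpa [shadow] using hx
    filter_upwards [measure_eq_zero_iff_ae_notMem.1 h0] with y hy h
    exact absurd h hy

lemma ae_swap {P : ℝ × ℝ → Prop} (h : ∀ᵐ p, P p) : ∀ᵐ p : ℝ × ℝ, P p.swap := by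
  rw [Measure.volume_eq_prod] at h ⊢
  exact Measure.measurePreserving_swap.quasiMeasurePreserving.ae h

lemma measurableSet_swap (hE : MeasurableSet E) : MeasurableSet (Prod.swap ⁻¹' E) :=
  measurable_swap hE

lemma volume_swap (E : Set (ℝ × ℝ)) : volume.real (Prod.swap ⁻¹' E) = volume.real E := by
  rw [measureReal_def, measureReal_def, Measure.volume_eq_prod]
  congr 1
  exact Measure.measurePreserving_swap.measure_preimage_equiv (f := MeasurableEquiv.prodComm) E

lemma ae_mem_shadow_swap (hE : MeasurableSet E) :
    ∀ᵐ p, p ∈ E → p.2 ∈ shadow (Prod.swap ⁻¹' E) := by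
  filter_upwards [ae_swap (ae_mem_shadow (measurableSet_swap hE))] with p hp h
  exact hp (by simpa using h)

lemma swap_subset_diamond (hD : E ⊆ diamond) : Prod.swap ⁻¹' E ⊆ diamond := fun p hp => by
  have : |p.2| + |p.1| < 1 := hD hp
  show |p.1| + |p.2| < 1
  linarith

lemma shadow_subset (hD : E ⊆ diamond) : shadow E ⊆ Ioo (-1) 1 := fun x hx => by
  obtain ⟨y, hy⟩ := nonempty_of_measure_ne_zero hx
  have : |x| + |y| < 1 := hD hy
  exact abs_lt.1 (by linarith [abs_nonneg y])

lemma volume_shadow_ne_top (hD : E ⊆ diamond) : volume (shadow E) ≠ ⊤ :=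
  ((measure_mono (shadow_subset hD)).trans_lt measure_Ioo_lt_top).ne

lemma volume_real_shadow_le (hD : E ⊆ diamond) : volume.real (shadow E) ≤ 2 := by
  have := measureReal_mono (shadow_subset hD) (μ := volume) measure_Ioo_lt_top.ne
  rw [Real.volume_real_Ioo_of_le (by norm_num)] at this
  linarith

lemma ae_le_of_forall {F : Set (ℝ × ℝ)} (h : ∀ᵐ p, p ∈ E → p ∈ F) : E ≤ᵐ[volume] F := h

lemma ae_subset_prod_shadow (hE : MeasurableSet E) :
    E ≤ᵐ[volume] shadow E ×ˢ shadow (Prod.swap ⁻¹' E) := by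
  refine ae_le_of_forall ?_
  filter_upwards [ae_mem_shadow hE, ae_mem_shadow_swap hE] with p h1 h2 hp
  exact ⟨h1 hp, h2 hp⟩

lemma volume_real_prod (A B : Set ℝ) :
    volume.real (A ×ˢ B) = volume.real A * volume.real B := by
  rw [Measure.volume_eq_prod, measureReal_prod_prod]

lemma ae_eq_of_ae_le_of_volume_real {F : Set (ℝ × ℝ)} (h : E ≤ᵐ[volume] F)
    (hE : MeasurableSet E) (hE' : volume E ≠ ⊤) (hF : volume F ≠ ⊤)
    (hv : volume.real F ≤ volume.real E) : E =ᵐ[volume] F :=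
  ae_eq_of_ae_subset_of_measure_ge h ((ENNReal.toReal_le_toReal hF hE').1 hv)
    hE.nullMeasurableSet hF

lemma volume_ne_top (hD : E ⊆ diamond) : volume E ≠ ⊤ :=
  ((measure_mono hD).trans_lt volume_diamond_ne_top.lt_top).ne

lemma volume_prod_shadow_ne_top (hD : E ⊆ diamond) :
    volume (shadow E ×ˢ shadow (Prod.swap ⁻¹' E)) ≠ ⊤ := by
  rw [Measure.volume_eq_prod, Measure.prod_prod]
  exact ENNReal.mul_ne_top (volume_shadow_ne_top hD) (volume_shadow_ne_top (swap_subset_diamond hD))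

lemma volume_real_le_mul_shadow (hE : MeasurableSet E) (hD : E ⊆ diamond) :
    volume.real E ≤ volume.real (shadow E) * volume.real (shadow (Prod.swap ⁻¹' E)) := by
  rw [← volume_real_prod]
  exact ENNReal.toReal_mono (volume_prod_shadow_ne_top hD)
    (measure_mono_ae (ae_subset_prod_shadow hE))

lemma two_sqrt_le_shadow (hE : MeasurableSet E) (hD : E ⊆ diamond) :
    2 * √(volume.real E) ≤ volume.real (shadow E) + volume.real (shadow (Prod.swap ⁻¹' E)) := by
  have h := volume_real_le_mul_shadow hE hD
  have h1 : 0 ≤ volume.real (shadow E) := measureReal_nonneg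
  have h2 : 0 ≤ volume.real (shadow (Prod.swap ⁻¹' E)) := measureReal_nonneg
  have h3 : √(volume.real E) ≤
      (volume.real (shadow E) + volume.real (shadow (Prod.swap ⁻¹' E))) / 2 :=
    Real.sqrt_le_iff.2 ⟨by positivity, by
      nlinarith [sq_nonneg (volume.real (shadow E) - volume.real (shadow (Prod.swap ⁻¹' E)))]⟩
  linarith

/-- Equality in the isoperimetric inequality forces the set to be a square up to holes in its
shadows. -/
lemma of_shadow_eq_two_sqrt (hE : MeasurableSet E) (hD : E ⊆ diamond)
    (h : volume.real (shadow E) + volume.real (shadow (Prod.swap ⁻¹' E))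
      ≤ 2 * √(volume.real E)) :
    volume.real (shadow E) = √(volume.real E) ∧
      volume.real (shadow (Prod.swap ⁻¹' E)) = √(volume.real E) ∧
      E =ᵐ[volume] shadow E ×ˢ shadow (Prod.swap ⁻¹' E) := by
  have h0 := volume_real_le_mul_shadow hE hD
  have h1 : 0 ≤ volume.real (shadow E) := measureReal_nonneg
  have h2 : 0 ≤ volume.real (shadow (Prod.swap ⁻¹' E)) := measureReal_nonneg
  have h3 := Real.sq_sqrt (measureReal_nonneg : 0 ≤ volume.real E)
  have h4 := Real.sqrt_nonneg (volume.real E)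
  set a := volume.real (shadow E)
  set b := volume.real (shadow (Prod.swap ⁻¹' E))
  set s := √(volume.real E)
  have hab : a - b = 0 := by
    have : (a - b) ^ 2 ≤ 0 := by nlinarith
    exact pow_eq_zero_iff two_ne_zero |>.1 (le_antisymm this (sq_nonneg _))
  have ha : a = s := le_antisymm (by linarith) (by nlinarith)
  refine ⟨ha, by linarith, ?_⟩
  refine ae_eq_of_ae_le_of_volume_real (ae_subset_prod_shadow hE) hE (volume_ne_top hD)
    (volume_prod_shadow_ne_top hD) ?_
  rw [volume_real_prod]
  show a * b ≤ _
  nlinarith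

/-- The bathtub principle for the profile `min b (1 - |x|)`. -/
lemma setIntegral_min_le {A : Set ℝ} (hA : MeasurableSet A) (hA1 : A ⊆ Ioo (-1) 1) {a b : ℝ}
    (ha : volume.real A = 2 * a) (hb : b ≤ 1) (hab : 1 ≤ a + b) :
    ∫ x in A, 2 * min b (1 - |x|) ≤ 2 - 2 * (1 - a) ^ 2 - 2 * (1 - b) ^ 2 ∧
    (2 - 2 * (1 - a) ^ 2 - 2 * (1 - b) ^ 2 ≤ ∫ x in A, 2 * min b (1 - |x|) →
      A =ᵐ[volume] Ioo (-a) a) := by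
  have ha0 : 0 ≤ a := by linarith [(measureReal_nonneg : 0 ≤ volume.real A)]
  have hAt : volume A ≠ ⊤ := ((measure_mono hA1).trans_lt measure_Ioo_lt_top).ne
  set G : ℝ → ℝ := fun x => 2 * min b (1 - |x|) with hG
  have hGc : Continuous G := by fun_prop
  have hGA : IntegrableOn G A :=
    (hGc.integrableOn_Icc (a := -1) (b := 1)).mono_set (hA1.trans Ioo_subset_Icc_self)
  have hGI : IntegrableOn G (Ioo (-a) a) :=
    (hGc.integrableOn_Icc (a := -a) (b := a)).mono_set Ioo_subset_Icc_self
  set θ := 2 * (1 - a) with hθ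
  have hcA : IntegrableOn (fun _ => θ) A := integrableOn_const hAt
  have hcI : IntegrableOn (fun _ => θ) (Ioo (-a) a) := integrableOn_const measure_Ioo_lt_top.ne
  have hI : ∫ x in Ioo (-a) a, G x = 2 - 2 * (1 - a) ^ 2 - 2 * (1 - b) ^ 2 := by
    rw [← integral_Ioc_eq_integral_Ioo, ← intervalIntegral.integral_of_le (by linarith)]
    exact intervalIntegral_min_eq hb hab
  set w : ℝ → ℝ := fun x => (Ioo (-a) a).indicator (fun x => G x - θ) x -
    A.indicator (fun x => G x - θ) x with hw
  have hwi1 : Integrable ((Ioo (-a) a).indicator fun x => G x - θ) :=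
    (integrable_indicator_iff measurableSet_Ioo).2 (hGI.sub hcI)
  have hwi2 : Integrable (A.indicator fun x => G x - θ) :=
    (integrable_indicator_iff hA).2 (hGA.sub hcA)
  have hwint : ∫ x, w x = (∫ x in Ioo (-a) a, G x) - ∫ x in A, G x := by
    rw [integral_sub hwi1 hwi2, integral_indicator measurableSet_Ioo, integral_indicator hA,
      integral_sub hGI hcI, integral_sub hGA hcA, setIntegral_const, setIntegral_const, ha,
      Real.volume_real_Ioo_of_le (by linarith)]
    simp only [smul_eq_mul]; ring
  have hin : ∀ x ∈ Ioo (-a) a, θ ≤ G x := fun x hx => by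
    have := abs_lt.2 hx
    have : 1 - a ≤ min b (1 - |x|) := le_min (by linarith) (by linarith)
    simp only [hG, hθ]; linarith
  have hout : ∀ x, a < |x| → G x < θ := fun x hx => by
    have := min_le_right b (1 - |x|)
    simp only [hG, hθ]; linarith
  have hout' : ∀ x, x ∉ Ioo (-a) a → G x ≤ θ := fun x hx => by
    have h1 : a ≤ |x| := by
      by_contra h
      exact hx (abs_lt.1 (by linarith))
    have := min_le_right b (1 - |x|)
    simp only [hG, hθ]; linarith
  have hw0 : ∀ x, 0 ≤ w x := fun x => by
    by_cases h1 : x ∈ Ioo (-a) a <;> by_cases h2 : x ∈ A <;> simp only [hw, indicator, h1, h2,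
      if_true, if_false]
    · simp
    · linarith [hin x h1]
    · linarith [hout' x h1]
    · simp
  have hwn : 0 ≤ ∫ x, w x := integral_nonneg hw0
  refine ⟨by linarith, fun h => ?_⟩
  have hz : ∫ x, w x = 0 := le_antisymm (by linarith) hwn
  rw [integral_eq_zero_iff_of_nonneg hw0 (hwi1.sub hwi2)] at hz
  have hne : ∀ᵐ x : ℝ, x ≠ a ∧ x ≠ -a := by
    have h1 : ∀ c : ℝ, ∀ᵐ x : ℝ, x ≠ c := fun c => by
      simpa using measure_eq_zero_iff_ae_notMem.1 (Real.volume_singleton (a := c))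
    exact (h1 a).and (h1 (-a))
  have hle : A ≤ᵐ[volume] Ioo (-a) a := by
    have : ∀ᵐ x, x ∈ A → x ∈ Ioo (-a) a := by
      filter_upwards [hz, hne] with x hx hx' hxA
      by_contra hxI
      have h1 : a ≤ |x| := by
        by_contra h
        exact hxI (abs_lt.1 (by linarith))
      have h2 : a < |x| := lt_of_le_of_ne h1 fun h => by
        rcases abs_choice x with h3 | h3
        · exact hx'.1 (by linarith)
        · exact hx'.2 (by linarith)
      have h3 := hout x h2
      simp only [hw, indicator, hxI, hxA, if_true, if_false, Pi.zero_apply] at hx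
      linarith
    exact this
  refine ae_eq_of_ae_subset_of_measure_ge hle ?_ hA.nullMeasurableSet measure_Ioo_lt_top.ne
  refine (ENNReal.toReal_le_toReal measure_Ioo_lt_top.ne hAt).1 ?_
  change volume.real _ ≤ volume.real _
  rw [Real.volume_real_Ioo_of_le (by linarith), ha]
  linarith

lemma volume_real_le_setIntegral_shadow (hE : MeasurableSet E) (hD : E ⊆ diamond) :
    volume.real E ≤
      ∫ x in shadow E, 2 * min (volume.real (shadow (Prod.swap ⁻¹' E)) / 2) (1 - |x|) := by
  have h1 := volume_ne_top hD
  have hS := measurableSet_shadow hE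
  have h2 : ∫ x, volume.real (Prod.mk x ⁻¹' E) = volume.real E := by
    rw [Measure.volume_eq_prod] at h1 ⊢
    rw [measureReal_def, Measure.prod_apply hE]
    exact integral_toReal (measurable_measure_prodMk_left hE).aemeasurable
      (Measure.ae_measure_lt_top hE h1)
  have hB := ae_mem_shadow_swap hE
  rw [Measure.volume_eq_prod] at hB
  have hB' := Measure.ae_ae_of_ae_prod hB
  have hGc : Continuous fun x : ℝ =>
      2 * min (volume.real (shadow (Prod.swap ⁻¹' E)) / 2) (1 - |x|) := by fun_prop
  have hI : Integrable fun x => volume.real (Prod.mk x ⁻¹' E) := by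
    rw [Measure.volume_eq_prod] at h1
    exact Measure.integrable_measure_prodMk_left hE h1
  rw [← h2, ← integral_indicator hS]
  refine integral_mono_ae hI ((integrable_indicator_iff hS).2
    ((hGc.integrableOn_Icc (a := -1) (b := 1)).mono_set
      ((shadow_subset hD).trans Ioo_subset_Icc_self))) ?_
  filter_upwards [hB'] with x hx
  by_cases hxS : x ∈ shadow E
  · rw [indicator_of_mem hxS]
    have hle1 : volume.real (Prod.mk x ⁻¹' E) ≤ volume.real (shadow (Prod.swap ⁻¹' E)) :=
      ENNReal.toReal_mono (volume_shadow_ne_top (swap_subset_diamond hD)) (measure_mono_ae hx)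
    have hx1 := shadow_subset hD hxS
    have hx2 : |x| < 1 := abs_lt.2 hx1
    have hle2 : volume.real (Prod.mk x ⁻¹' E) ≤ 2 * (1 - |x|) := by
      have hs : Prod.mk x ⁻¹' E ⊆ Ioo (-(1 - |x|)) (1 - |x|) := fun y hy => by
        have : |x| + |y| < 1 := hD hy
        exact abs_lt.1 (by linarith)
      have := measureReal_mono hs (μ := volume) measure_Ioo_lt_top.ne
      rw [Real.volume_real_Ioo_of_le (by linarith)] at this
      linarith
    rcases min_cases (volume.real (shadow (Prod.swap ⁻¹' E)) / 2) (1 - |x|) with h | h <;>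
      simp only [h.1] <;> linarith
  · have h0 : volume (Prod.mk x ⁻¹' E) = 0 := by simpa [shadow] using hxS
    simp [hxS, measureReal_def, h0]

lemma volume_real_le_of_shadow (hE : MeasurableSet E) (hD : E ⊆ diamond) {a b : ℝ}
    (ha : volume.real (shadow E) = 2 * a) (hb : volume.real (shadow (Prod.swap ⁻¹' E)) = 2 * b)
    (hab : 1 ≤ a + b) :
    volume.real E ≤ 2 - 2 * (1 - a) ^ 2 - 2 * (1 - b) ^ 2 ∧
    (2 - 2 * (1 - a) ^ 2 - 2 * (1 - b) ^ 2 ≤ volume.real E →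
      shadow E =ᵐ[volume] Ioo (-a) a) := by
  have h1 := volume_real_le_setIntegral_shadow hE hD
  have h2 := volume_real_shadow_le (swap_subset_diamond hD)
  have h3 := setIntegral_min_le (measurableSet_shadow hE) (shadow_subset hD) ha
    (by linarith : b ≤ 1) hab
  rw [hb, show 2 * b / 2 = b by ring] at h1
  exact ⟨h1.trans h3.1, fun h => h3.2 (h.trans h1)⟩

lemma sqrt_le_shadow (hE : MeasurableSet E) (hD : E ⊆ diamond) (hM : 1 ≤ volume.real E) :
    4 - 2 * √(2 - volume.real E) ≤
      volume.real (shadow E) + volume.real (shadow (Prod.swap ⁻¹' E)) := by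
  have h1 := two_sqrt_le_shadow hE hD
  have h2 : 1 ≤ √(volume.real E) := Real.one_le_sqrt.2 hM
  set a := volume.real (shadow E) / 2 with ha
  set b := volume.real (shadow (Prod.swap ⁻¹' E)) / 2 with hb
  have h3 := (volume_real_le_of_shadow hE hD (a := a) (b := b) (by linarith) (by linarith)
    (by linarith)).1
  have h4 : (1 - a) + (1 - b) ≤ √(2 - volume.real E) :=
    Real.le_sqrt_of_sq_le (by nlinarith [sq_nonneg (a - b)])
  linarith

/-- Equality in the isoperimetric inequality in the diamond. -/
lemma of_shadow_eq_sqrt (hE : MeasurableSet E) (hD : E ⊆ diamond) (hM : 1 ≤ volume.real E)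
    (h : volume.real (shadow E) + volume.real (shadow (Prod.swap ⁻¹' E)) ≤
      4 - 2 * √(2 - volume.real E)) :
    E =ᵐ[volume] octagon (1 - √(2 - volume.real E) / 2) := by
  have h1 := two_sqrt_le_shadow hE hD
  have h2 : 1 ≤ √(volume.real E) := Real.one_le_sqrt.2 hM
  have hE' := measurableSet_swap hE
  have hD' := swap_subset_diamond hD
  have ha1 := volume_real_shadow_le hD
  have hb1 := volume_real_shadow_le hD'
  set a := volume.real (shadow E) / 2 with ha
  set b := volume.real (shadow (Prod.swap ⁻¹' E)) / 2 with hb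
  have hv := volume_real_le_of_shadow hE hD (a := a) (b := b) (by linarith) (by linarith)
    (by linarith)
  have hv' := volume_real_le_of_shadow hE' hD' (a := b) (b := a) (by linarith)
    (by rw [← preimage_comp]; simp; linarith) (by linarith)
  rw [volume_swap] at hv'
  have hM2 : 0 ≤ 2 - volume.real E := by nlinarith [hv.1, sq_nonneg (1 - a), sq_nonneg (1 - b)]
  have h5 := Real.sq_sqrt hM2
  have h6 := Real.sqrt_nonneg (2 - volume.real E)
  set s := √(2 - volume.real E) with hs
  have h7 : s ≤ (1 - a) + (1 - b) := by linarith
  have hab : a - b = 0 := by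
    have : (a - b) ^ 2 ≤ 0 := by nlinarith [hv.1]
    exact pow_eq_zero_iff two_ne_zero |>.1 (le_antisymm this (sq_nonneg _))
  have hsa : s = 2 * (1 - a) := le_antisymm (by linarith) (by nlinarith [hv.1])
  have heq : 2 - 2 * (1 - a) ^ 2 - 2 * (1 - b) ^ 2 ≤ volume.real E := by
    have : b = a := by linarith
    rw [this]; nlinarith
  have hA := hv.2 heq
  have hB := hv'.2 (by linarith)
  have hc : 1 - s / 2 = a := by linarith
  rw [hc]
  have hba : b = a := by linarith
  rw [hba] at hB
  have hsub : E ≤ᵐ[volume] octagon a := by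
    have e1 : ∀ᵐ p : ℝ × ℝ, p.1 ∈ shadow E → p.1 ∈ Ioo (-a) a := by
      rw [Measure.volume_eq_prod]
      exact Measure.quasiMeasurePreserving_fst.ae hA.le
    have e2 : ∀ᵐ p : ℝ × ℝ, p.2 ∈ shadow (Prod.swap ⁻¹' E) → p.2 ∈ Ioo (-a) a := by
      rw [Measure.volume_eq_prod]
      exact Measure.quasiMeasurePreserving_snd.ae hB.le
    refine ae_le_of_forall ?_
    filter_upwards [e1, e2, ae_mem_shadow hE, ae_mem_shadow_swap hE] with p h1 h2 h3 h4 hp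
    exact ⟨abs_lt.2 (h1 (h3 hp)), abs_lt.2 (h2 (h4 hp)), hD hp⟩
  refine ae_eq_of_ae_le_of_volume_real hsub hE (volume_ne_top hD)
    (volume_ne_top (octagon_subset_diamond a)) ?_
  rw [volume_real_octagon_of_ge (by linarith) (by linarith)]
  rw [hba] at heq
  linarith

end shadow

/-- A vertical flux density that becomes a flux after balancing it outside the diamond. -/
structure IsPreFlux (κ : ℝ × ℝ → ℝ) : Prop where
  measurable : Measurable κ
  bounded : ∃ C, ∀ p, |κ p| ≤ C
  support : ∀ p, κ p ≠ 0 → p ∈ Icc (-1 : ℝ) 1 ×ˢ Icc (-1 : ℝ) 1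
  prim : ∀ x y, |(∫ z in Iic y, κ (x, z)) - (∫ z, κ (x, z)) / 2| ≤ 1

namespace IsPreFlux
variable {κ : ℝ × ℝ → ℝ}

lemma integrable (h : IsPreFlux κ) : Integrable κ := by
  obtain ⟨C, hC⟩ := h.bounded
  exact integrable_of_bounded_support h.measurable (measurableSet_Icc.prod measurableSet_Icc)
    (isCompact_Icc.prod isCompact_Icc).measure_lt_top.ne hC h.support

lemma integrable_slice (h : IsPreFlux κ) (x : ℝ) : Integrable fun z => κ (x, z) := by
  obtain ⟨C, hC⟩ := h.bounded
  exact integrable_of_bounded_support (h.measurable.comp measurable_prodMk_left) measurableSet_Icc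
    (isCompact_Icc (a := (-1 : ℝ)) (b := 1)).measure_lt_top.ne (fun z => hC _)
    fun z hz => (h.support _ hz).2

lemma setIntegral_Iic_of_lt (h : IsPreFlux κ) (x : ℝ) {y : ℝ} (hy : y < -1) :
    ∫ z in Iic y, κ (x, z) = 0 := by
  refine setIntegral_eq_zero_of_forall_eq_zero fun z (hz : z ≤ y) => ?_
  by_contra hne
  have := (h.support _ hne).2.1
  simp only at this
  linarith

lemma setIntegral_Iic_of_gt (h : IsPreFlux κ) (x : ℝ) {y : ℝ} (hy : 1 ≤ y) :
    ∫ z in Iic y, κ (x, z) = ∫ z, κ (x, z) := by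
  refine setIntegral_eq_integral_of_forall_compl_eq_zero fun z hz => ?_
  by_contra hne
  exact hz ((h.support _ hne).2.2.trans hy)

lemma exists_isFlux (h : IsPreFlux κ) :
    ∃ κ', IsFlux κ' ∧ ∀ p ∈ Icc (-1 : ℝ) 1 ×ˢ Icc (-1 : ℝ) 1, κ' p = κ p := by
  set c : ℝ → ℝ := fun x => ∫ z, κ (x, z) with hc
  set l : ℝ → ℝ := (Icc (-3) (-2)).indicator 1 with hl
  set r : ℝ → ℝ := (Icc 2 3).indicator 1 with hr
  have hcm : Measurable c :=
    (StronglyMeasurable.integral_prod_right (f := fun x z => κ (x, z))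
      h.measurable.stronglyMeasurable).measurable
  have hlm : Measurable l := measurable_one.indicator measurableSet_Icc
  have hrm : Measurable r := measurable_one.indicator measurableSet_Icc
  have hli : Integrable l :=
    (integrable_indicator_iff measurableSet_Icc).2 (integrableOn_const (by simp))
  have hri : Integrable r :=
    (integrable_indicator_iff measurableSet_Icc).2 (integrableOn_const (by simp))
  have hl1 : ∀ z, 0 ≤ l z ∧ l z ≤ 1 := fun z => by
    by_cases hz : z ∈ Icc (-3 : ℝ) (-2) <;> simp [hl, hz]
  have hr1 : ∀ z, 0 ≤ r z ∧ r z ≤ 1 := fun z => by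
    by_cases hz : z ∈ Icc (2 : ℝ) 3 <;> simp [hr, hz]
  have hlt : ∫ z, l z = 1 := by
    rw [hl, integral_indicator_one measurableSet_Icc, Real.volume_real_Icc_of_le] <;> norm_num
  have hrt : ∫ z, r z = 1 := by
    rw [hr, integral_indicator_one measurableSet_Icc, Real.volume_real_Icc_of_le] <;> norm_num
  have hc2 : ∀ x, |c x| ≤ 2 := fun x => by
    have := h.prim x (-2)
    rw [h.setIntegral_Iic_of_lt x (by norm_num), zero_sub, abs_neg, abs_div] at this
    norm_num at this
    linarith
  set κ' : ℝ × ℝ → ℝ := fun p => κ p -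
    c p.1 / 2 * (l p.2 + r p.2) with hκ'
  have hcout : ∀ x, x ∉ Icc (-1 : ℝ) 1 → c x = 0 := fun x hx => by
    simp only [hc]
    rw [integral_eq_zero_of_ae]
    refine Eventually.of_forall fun z => ?_
    by_contra hne
    exact hx (h.support (x, z) hne).1
  have hsl : ∀ x, Integrable fun z => c x / 2 * (l z + r z) := fun x =>
    (hli.add hri).const_mul _
  refine ⟨κ', ⟨?_, ?_, ?_, ?_, ?_⟩, ?_⟩
  · exact h.measurable.sub (((hcm.comp measurable_fst).div_const 2).mul
      ((hlm.comp measurable_snd).add (hrm.comp measurable_snd)))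
  · obtain ⟨C, hC⟩ := h.bounded
    refine ⟨C + 2, fun p => ?_⟩
    have h1 := abs_sub (κ p) (c p.1 / 2 * (l p.2 + r p.2))
    have h2 : |c p.1 / 2 * (l p.2 + r p.2)| ≤ 1 * 2 := by
      rw [abs_mul]
      refine mul_le_mul ?_ ?_ (abs_nonneg _) zero_le_one
      · rw [abs_div, abs_two]; linarith [hc2 p.1]
      · rw [abs_of_nonneg (add_nonneg (hl1 _).1 (hr1 _).1)]
        linarith [(hl1 p.2).2, (hr1 p.2).2]
    simp only [hκ']
    linarith [hC p]
  · intro p hp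
    by_contra hout
    refine hp ?_
    have h1 : κ p = 0 := by
      by_contra hne
      have := h.support p hne
      exact hout ⟨⟨by linarith [this.1.1], by linarith [this.1.2]⟩,
        ⟨by linarith [this.2.1], by linarith [this.2.2]⟩⟩
    simp only [hκ', h1, zero_sub, neg_eq_zero]
    by_cases hx : p.1 ∈ Icc (-1 : ℝ) 1
    · have hy : p.2 ∉ Icc (-3 : ℝ) 3 := fun hy =>
        hout ⟨⟨by linarith [hx.1], by linarith [hx.2]⟩, hy⟩
      have h2 : l p.2 = 0 := indicator_of_notMem (fun h' => hy ⟨h'.1, by linarith [h'.2]⟩) _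
      have h3 : r p.2 = 0 := indicator_of_notMem (fun h' => hy ⟨by linarith [h'.1], h'.2⟩) _
      rw [h2, h3]; ring
    · rw [hcout _ hx]; ring
  · intro x y
    have e1 : ∫ z in Iic y, κ' (x, z) = (∫ z in Iic y, κ (x, z)) -
        c x / 2 * ((∫ z in Iic y, l z) + ∫ z in Iic y, r z) := by
      simp only [hκ']
      rw [integral_sub (h.integrable_slice x).integrableOn (hsl x).integrableOn,
        integral_const_mul, integral_add hli.integrableOn hri.integrableOn]
    have hb : ∀ g : ℝ → ℝ, Integrable g → (∀ z, 0 ≤ g z ∧ g z ≤ 1) → ∫ z, g z = 1 →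
        0 ≤ (∫ z in Iic y, g z) ∧ (∫ z in Iic y, g z) ≤ 1 := fun g hg h1 h2 =>
      ⟨setIntegral_nonneg measurableSet_Iic fun z _ => (h1 z).1, by
        rw [← h2]; exact setIntegral_le_integral hg (Eventually.of_forall fun z => (h1 z).1)⟩
    have hL := hb l hli hl1 hlt
    have hR := hb r hri hr1 hrt
    have hc2x := abs_le.1 (hc2 x)
    rw [e1]
    rcases lt_or_ge y (-1) with hy | hy
    · rw [h.setIntegral_Iic_of_lt x hy]
      have : ∫ z in Iic y, r z = 0 := by
        refine setIntegral_eq_zero_of_forall_eq_zero fun z (hz : z ≤ y) => ?_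
        exact indicator_of_notMem (fun h' => by linarith [h'.1]) _
      rw [this, abs_le]
      constructor <;> nlinarith
    · have : ∫ z in Iic y, l z = 1 := by
        rw [← hlt]
        refine setIntegral_eq_integral_of_forall_compl_eq_zero fun z hz => ?_
        exact indicator_of_notMem (fun h' => hz (show z ≤ y by linarith [h'.2])) _
      rw [this]
      rcases le_or_gt y 1 with hy1 | hy1
      · have h0 : ∫ z in Iic y, r z = 0 := by
          refine setIntegral_eq_zero_of_forall_eq_zero fun z (hz : z ≤ y) => ?_
          exact indicator_of_notMem (fun h' => by linarith [h'.1]) _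
        rw [h0]
        have := h.prim x y
        simpa [hc] using this
      · rw [h.setIntegral_Iic_of_gt x hy1.le]
        change |c x - _| ≤ 1
        rw [abs_le]
        constructor <;> nlinarith
  · intro x
    simp only [hκ']
    rw [integral_sub (h.integrable_slice x) (hsl x), integral_const_mul, integral_add hli hri,
      hlt, hrt]
    simp only [hc]; ring
  · intro p hp
    have h2 : l p.2 = 0 := indicator_of_notMem (fun h' => by linarith [h'.2, hp.2.1]) _
    have h3 : r p.2 = 0 := indicator_of_notMem (fun h' => by linarith [h'.1, hp.2.2]) _
    simp only [hκ']
    rw [h2, h3]; ring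

end IsPreFlux

lemma FluxBound.preFlux {f : ℝ × ℝ → ℝ} {C : ℝ} (hf : FluxBound f C)
    (hs : ∀ p, f p ≠ 0 → p ∈ diamond) {κ γ : ℝ × ℝ → ℝ} (hκ : IsPreFlux κ) (hγ : IsPreFlux γ) :
    (∫ p, f p * κ p) + (∫ p, f p.swap * γ p) ≤ 2 * C := by
  obtain ⟨κ', h1, h2⟩ := hκ.exists_isFlux
  obtain ⟨γ', h3, h4⟩ := hγ.exists_isFlux
  have e1 : ∀ p, f p * κ p = f p * κ' p := fun p => by
    by_cases hp : f p = 0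
    · simp [hp]
    · rw [h2 p (diamond_subset_box (hs p hp))]
  have e2 : ∀ p, f p.swap * γ p = f p.swap * γ' p := fun p => by
    by_cases hp : f p.swap = 0
    · simp [hp]
    · have := diamond_subset_box (hs _ hp)
      rw [h4 p ⟨this.2, this.1⟩]
  simp only [e1, e2]
  exact hf κ' γ' h1 h3

/-- A bounded measurable `ℕ`-valued function vanishing outside the diamond. -/
structure IsProfile (ν : ℝ × ℝ → ℕ) (N : ℕ) : Prop where
  measurable : Measurable ν
  le : ∀ p, ν p ≤ N
  support : ∀ p, ν p ≠ 0 → p ∈ diamond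

/-- The superlevel set `{ν ≥ j}`. -/
def level (ν : ℝ × ℝ → ℕ) (j : ℕ) : Set (ℝ × ℝ) := {p | j ≤ ν p}

open Classical in
/-- The essential supremum of `ν` along the vertical line through `x`. -/
def top (ν : ℝ × ℝ → ℕ) (N : ℕ) (x : ℝ) : ℕ := Nat.findGreatest (fun j => x ∈ shadow (level ν j)) N

/-- The set where `ν` reaches its essential supremum along vertical lines. -/
def peak (ν : ℝ × ℝ → ℕ) (N : ℕ) : Set (ℝ × ℝ) := {p | 1 ≤ ν p ∧ top ν N p.1 ≤ ν p}

namespace IsProfile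
variable {ν : ℝ × ℝ → ℕ} {N : ℕ}

lemma swap (h : IsProfile ν N) : IsProfile (fun p => ν p.swap) N where
  measurable := h.measurable.comp measurable_swap
  le _ := h.le _
  support _ hp := swap_subset_diamond subset_rfl (h.support _ hp)

lemma measurableSet_level (h : IsProfile ν N) (j : ℕ) : MeasurableSet (level ν j) :=
  h.measurable measurableSet_Ici

lemma level_subset (h : IsProfile ν N) {j : ℕ} (hj : 1 ≤ j) : level ν j ⊆ diamond := fun p hp =>
  h.support p (by have : j ≤ ν p := hp; omega)

lemma level_antitone {i j : ℕ} (hij : i ≤ j) : level ν j ⊆ level ν i := fun _ hp => hij.trans hp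

lemma measurable_top (h : IsProfile ν N) : Measurable (top ν N) := by
  classical
  exact measurable_findGreatest fun k _ => measurableSet_shadow (h.measurableSet_level k)

lemma top_le (ν : ℝ × ℝ → ℕ) (N : ℕ) (x : ℝ) : top ν N x ≤ N := by
  classical
  exact Nat.findGreatest_le N

lemma mem_shadow_iff {x : ℝ} {j : ℕ} (hj : 1 ≤ j) (hjN : j ≤ N) :
    x ∈ shadow (level ν j) ↔ j ≤ top ν N x := by
  classical
  constructor
  · exact fun hx => Nat.le_findGreatest hjN hx
  · intro hx
    have h0 : top ν N x ≠ 0 := by omega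
    have := Nat.findGreatest_of_ne_zero (P := fun j => x ∈ shadow (level ν j)) (n := N) rfl h0
    exact shadow_mono (level_antitone hx) this

lemma sum_indicator_shadow (x : ℝ) :
    ∑ j ∈ Finset.Icc 1 N, (shadow (level ν j)).indicator (fun _ => (1 : ℝ)) x = top ν N x := by
  classical
  have : ∀ j ∈ Finset.Icc 1 N, (shadow (level ν j)).indicator (fun _ => (1 : ℝ)) x
      = if j ≤ top ν N x then 1 else 0 := fun j hj => by
    rw [Finset.mem_Icc] at hj
    simp only [indicator, mem_shadow_iff hj.1 hj.2]
  rw [Finset.sum_congr rfl this, Finset.sum_boole]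
  have : Finset.filter (fun j => j ≤ top ν N x) (Finset.Icc 1 N) = Finset.Icc 1 (top ν N x) := by
    ext j
    have := top_le ν N x
    simp only [Finset.mem_filter, Finset.mem_Icc]
    omega
  rw [this]
  simp

lemma integral_top (h : IsProfile ν N) :
    Integrable (fun x => (top ν N x : ℝ)) ∧
    ∫ x, (top ν N x : ℝ) = ∑ j ∈ Finset.Icc 1 N, volume.real (shadow (level ν j)) := by
  have hi : ∀ j ∈ Finset.Icc 1 N,
      Integrable ((shadow (level ν j)).indicator fun _ => (1 : ℝ)) := fun j hj =>
    (integrable_indicator_iff (measurableSet_shadow (h.measurableSet_level j))).2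
      (integrableOn_const (volume_shadow_ne_top (h.level_subset (Finset.mem_Icc.1 hj).1)))
  simp only [← sum_indicator_shadow]
  refine ⟨integrable_finsetSum _ hi, ?_⟩
  rw [integral_finsetSum _ hi]
  refine Finset.sum_congr rfl fun j _ => ?_
  exact integral_indicator_one (measurableSet_shadow (h.measurableSet_level j))

lemma measurableSet_peak (h : IsProfile ν N) : MeasurableSet (peak ν N) :=
  (h.measurable measurableSet_Ici).inter
    (measurableSet_le (h.measurable_top.comp measurable_fst) h.measurable)

lemma peak_subset (h : IsProfile ν N) : peak ν N ⊆ diamond := fun p hp =>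
  h.support p (by have := hp.1; omega)

lemma volume_real_peak_pos (h : IsProfile ν N) {x : ℝ} (hx : 1 ≤ top ν N x) :
    0 < volume.real (Prod.mk x ⁻¹' peak ν N) := by
  have h1 : x ∈ shadow (level ν (top ν N x)) := (mem_shadow_iff hx (top_le ν N x)).2 le_rfl
  have h2 : Prod.mk x ⁻¹' peak ν N = Prod.mk x ⁻¹' level ν (top ν N x) := by
    ext z
    exact ⟨fun hz => hz.2, fun hz => ⟨hx.trans hz, hz⟩⟩
  rw [h2]
  refine ENNReal.toReal_pos h1 (((measure_mono ?_).trans_lt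
    (measure_Icc_lt_top (a := (-1 : ℝ)) (b := 1))).ne)
  exact fun z hz => (diamond_subset_box (h.level_subset hx hz)).2

/-- A vertical density concentrated where `ν` is maximal, with mass almost `1` on each line. -/
def peakDensity (ν : ℝ × ℝ → ℕ) (N : ℕ) (ε : ℝ) : ℝ × ℝ → ℝ :=
  (peak ν N).indicator fun p => 1 / (volume.real (Prod.mk p.1 ⁻¹' peak ν N) + ε)

section peakDensity
variable {ε : ℝ}

lemma peakDensity_nonneg (hε : 0 < ε) (p : ℝ × ℝ) : 0 ≤ peakDensity ν N ε p :=
  indicator_nonneg (fun _ _ => by positivity) _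

lemma peakDensity_le (hε : 0 < ε) (p : ℝ × ℝ) : peakDensity ν N ε p ≤ 1 / ε := by
  refine indicator_le_self' (fun _ _ => by positivity) p |>.trans ?_
  exact one_div_le_one_div_of_le hε (le_add_of_nonneg_left measureReal_nonneg)

lemma measurable_slice (h : IsProfile ν N) :
    Measurable fun x => volume.real (Prod.mk x ⁻¹' peak ν N) :=
  (measurable_measure_prodMk_left h.measurableSet_peak).ennreal_toReal

lemma measurable_peakDensity (h : IsProfile ν N) : Measurable (peakDensity ν N ε) :=
  Measurable.indicator (((h.measurable_slice.comp measurable_fst).add_const ε).const_div 1)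
    h.measurableSet_peak

lemma integral_peakDensity (h : IsProfile ν N) (x : ℝ) :
    ∫ z, peakDensity ν N ε (x, z) = volume.real (Prod.mk x ⁻¹' peak ν N) /
      (volume.real (Prod.mk x ⁻¹' peak ν N) + ε) := by
  have : (fun z => peakDensity ν N ε (x, z)) = (Prod.mk x ⁻¹' peak ν N).indicator
      fun _ => 1 / (volume.real (Prod.mk x ⁻¹' peak ν N) + ε) := rfl
  rw [this, integral_indicator (measurable_prodMk_left h.measurableSet_peak), setIntegral_const,
    smul_eq_mul, mul_one_div]

lemma integrable_peakDensity (h : IsProfile ν N) (hε : 0 < ε) (x : ℝ) :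
    Integrable fun z => peakDensity ν N ε (x, z) :=
  integrable_of_bounded_support (h.measurable_peakDensity.comp measurable_prodMk_left)
    measurableSet_Icc (measure_Icc_lt_top (a := (-1 : ℝ)) (b := 1)).ne
    (fun z => by rw [abs_of_nonneg (peakDensity_nonneg hε _)]; exact peakDensity_le hε _)
    fun z hz => (diamond_subset_box (h.peak_subset (mem_of_indicator_ne_zero hz))).2

end peakDensity

/-- The sum of the lengths of the shadows is attained, up to a small error, by a flux. On the lines
through `B` the flux `g` may be used instead. -/
lemma exists_preFlux (h : IsProfile ν N) {B : Set ℝ} (hB : MeasurableSet B) (hB1 : B ⊆ Icc (-1) 1)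
    {g : ℝ → ℝ} (hg : Measurable g) (hgb : ∃ C, ∀ z, |g z| ≤ C)
    (hgs : ∀ z, g z ≠ 0 → z ∈ Icc (-1 : ℝ) 1) (hgp : ∀ y, |(∫ z in Iic y, g z) - 1| ≤ 1)
    (hgt : ∫ z, g z = 2)
    (hgν : ∀ᵐ x, x ∈ B → 2 * (top ν N x : ℝ) + 2 ≤ ∫ z, (ν (x, z) : ℝ) * g z)
    {δ : ℝ} (hδ : 0 < δ) :
    ∃ κ, IsPreFlux κ ∧
      2 * (∑ j ∈ Finset.Icc 1 N, volume.real (shadow (level ν j)) + volume.real B) - δ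
        ≤ ∫ p, (ν p : ℝ) * κ p := by
  classical
  set L : ℝ → ℝ := fun x => volume.real (Prod.mk x ⁻¹' peak ν N) with hL
  have hL0 : ∀ x, 0 ≤ L x := fun x => measureReal_nonneg
  set κ : ℝ → ℝ × ℝ → ℝ := fun ε p => if p.1 ∈ B then g p.2 else 2 * peakDensity ν N ε p with hκ
  set H : ℝ → ℝ → ℝ := fun ε x =>
    if x ∈ B then 2 * (top ν N x : ℝ) + 2 else 2 * top ν N x * (L x / (L x + ε)) with hH
  have hpre : ∀ ε, 0 < ε → IsPreFlux (κ ε) := fun ε hε => by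
    refine ⟨?_, ?_, ?_, ?_⟩
    · exact Measurable.ite (measurable_fst hB) (hg.comp measurable_snd)
        (h.measurable_peakDensity.const_mul 2)
    · obtain ⟨C, hC⟩ := hgb
      refine ⟨max C (2 * (1 / ε)), fun p => ?_⟩
      simp only [hκ]
      split_ifs
      · exact (hC _).trans (le_max_left _ _)
      · rw [abs_of_nonneg (mul_nonneg zero_le_two (peakDensity_nonneg hε _))]
        exact (mul_le_mul_of_nonneg_left (peakDensity_le hε _) zero_le_two).trans (le_max_right _ _)
    · intro p hp
      simp only [hκ] at hp
      split_ifs at hp with hpB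
      · exact ⟨hB1 hpB, hgs _ hp⟩
      · exact diamond_subset_box
          (h.peak_subset (mem_of_indicator_ne_zero (right_ne_zero_of_mul hp)))
    · intro x y
      by_cases hx : x ∈ B
      · simp only [hκ, hx, if_true, hgt]
        simpa using hgp y
      · simp only [hκ, hx, if_false]
        rw [integral_const_mul, integral_const_mul]
        have h1 := h.integral_peakDensity (ε := ε) x
        have h2 : ∫ z, peakDensity ν N ε (x, z) ≤ 1 := by
          rw [h1]; exact div_le_one_of_le₀ (by linarith) (by linarith [hL0 x])
        have h3 : 0 ≤ ∫ z in Iic y, peakDensity ν N ε (x, z) :=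
          setIntegral_nonneg measurableSet_Iic fun z _ => peakDensity_nonneg hε _
        have h4 : ∫ z in Iic y, peakDensity ν N ε (x, z) ≤ ∫ z, peakDensity ν N ε (x, z) :=
          setIntegral_le_integral (h.integrable_peakDensity hε x)
            (Eventually.of_forall fun z => peakDensity_nonneg hε _)
        rw [abs_le]
        constructor <;> linarith
  have hνm : Measurable fun p => (ν p : ℝ) := measurable_from_top.comp h.measurable
  have hmul : ∀ ε, 0 < ε → Integrable fun p => (ν p : ℝ) * κ ε p := fun ε hε =>
    (hpre ε hε).integrable.bdd_mul hνm.aestronglyMeasurable (c := N) <| Eventually.of_forall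
      fun p => by simpa using h.le p
  have hlow : ∀ ε, 0 < ε → Integrable (H ε) → ∫ x, H ε x ≤ ∫ p, (ν p : ℝ) * κ ε p :=
    fun ε hε hHi => by
    have hm := hmul ε hε
    rw [Measure.volume_eq_prod] at hm ⊢
    rw [integral_prod _ hm]
    refine integral_mono_ae hHi hm.integral_prod_left ?_
    filter_upwards [hgν] with x hx
    by_cases hxB : x ∈ B
    · simp only [hH, hκ, hxB, if_true]
      exact hx hxB
    · simp only [hH, hκ, hxB, if_false]
      have h1 := h.integral_peakDensity (ε := ε) x
      have h5 : 2 * (top ν N x : ℝ) * (L x / (L x + ε))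
          = ∫ z, 2 * (top ν N x : ℝ) * peakDensity ν N ε (x, z) := by
        rw [integral_const_mul, h1]
      rw [h5]
      refine integral_mono ((h.integrable_peakDensity hε x).const_mul _) ?_ fun z => ?_
      · exact ((h.integrable_peakDensity hε x).const_mul 2).bdd_mul
          (hνm.comp measurable_prodMk_left).aestronglyMeasurable (c := N) <| Eventually.of_forall
          fun z => by simpa using h.le (x, z)
      · by_cases hz : (x, z) ∈ peak ν N
        · have h6 : (top ν N x : ℝ) ≤ ν (x, z) := by exact_mod_cast hz.2
          have := mul_le_mul_of_nonneg_right h6 (peakDensity_nonneg (ν := ν) (N := N) hε (x, z))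
          simp only
          linarith
        · simp [peakDensity, hz]
  have hmeasH : ∀ ε, Measurable (H ε) := fun ε => by
    have ht : Measurable fun x => (top ν N x : ℝ) := measurable_from_top.comp h.measurable_top
    exact Measurable.ite hB ((ht.const_mul 2).add_const 2)
      ((ht.const_mul 2).mul (h.measurable_slice.div (h.measurable_slice.add_const ε)))
  have htop0 : ∀ x, x ∉ Icc (-1 : ℝ) 1 → top ν N x = 0 := fun x hx => by
    by_contra hne
    have h1 : 1 ≤ top ν N x := by omega
    have h2 := (mem_shadow_iff h1 (top_le ν N x)).2 le_rfl
    exact hx (Ioo_subset_Icc_self (shadow_subset (h.level_subset h1) h2))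
  set bd : ℝ → ℝ := (Icc (-1) 1).indicator fun _ => 2 * (N : ℝ) + 2 with hbd
  have hbdi : Integrable bd :=
    (integrable_indicator_iff measurableSet_Icc).2 (integrableOn_const (by simp))
  have hbound : ∀ ε, 0 < ε → ∀ x, ‖H ε x‖ ≤ bd x := fun ε hε x => by
    have htN : (top ν N x : ℝ) ≤ N := by exact_mod_cast top_le ν N x
    have ht0 : (0 : ℝ) ≤ top ν N x := by positivity
    have hq0 : 0 ≤ L x / (L x + ε) := div_nonneg (hL0 x) (by linarith [hL0 x])
    have hq1 : L x / (L x + ε) ≤ 1 := div_le_one_of_le₀ (by linarith) (by linarith [hL0 x])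
    by_cases hx : x ∈ Icc (-1 : ℝ) 1
    · simp only [hbd, indicator_of_mem hx, hH]
      split_ifs
      · rw [Real.norm_of_nonneg (by positivity)]; linarith
      · rw [Real.norm_of_nonneg (by positivity)]; nlinarith
    · have : x ∉ B := fun h' => hx (hB1 h')
      simp [hbd, hH, hx, this, htop0 x hx]
  have hHint : ∀ ε, 0 < ε → Integrable (H ε) := fun ε hε =>
    hbdi.mono' (hmeasH ε).aestronglyMeasurable (Eventually.of_forall (hbound ε hε))
  set Hl : ℝ → ℝ := fun x => 2 * (top ν N x : ℝ) + B.indicator (fun _ => 2) x with hHl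
  have hlim : Tendsto (fun n : ℕ => ∫ x, H (1 / ((n : ℝ) + 1)) x) atTop (nhds (∫ x, Hl x)) := by
    refine tendsto_integral_of_dominated_convergence bd
      (fun n => (hmeasH _).aestronglyMeasurable) hbdi
      (fun n => Eventually.of_forall (hbound _ Nat.one_div_pos_of_nat)) ?_
    refine Eventually.of_forall fun x => ?_
    by_cases hxB : x ∈ B
    · simp only [hH, hHl, hxB, if_true, indicator_of_mem hxB]
      exact tendsto_const_nhds
    · simp only [hH, hHl, hxB, if_false, indicator_of_notMem hxB, add_zero]
      by_cases ht : top ν N x = 0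
      · simp [ht]
      · have hLx : L x ≠ 0 := (h.volume_real_peak_pos (by omega)).ne'
        have h1 : Tendsto (fun n : ℕ => L x / (L x + 1 / ((n : ℝ) + 1))) atTop
            (nhds (L x / (L x + 0))) :=
          tendsto_const_nhds.div (tendsto_const_nhds.add tendsto_one_div_add_atTop_nhds_zero_nat)
            (by simpa using hLx)
        rw [add_zero, div_self hLx] at h1
        simpa using h1.const_mul (2 * (top ν N x : ℝ))
  have hHlv : ∫ x, Hl x
      = 2 * (∑ j ∈ Finset.Icc 1 N, volume.real (shadow (level ν j)) + volume.real B) := by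
    have hBt : volume B ≠ ⊤ := ((measure_mono hB1).trans_lt measure_Icc_lt_top).ne
    rw [integral_add (h.integral_top.1.const_mul 2)
      ((integrable_indicator_iff hB).2 (integrableOn_const hBt)), integral_const_mul,
      h.integral_top.2, integral_indicator hB, setIntegral_const, smul_eq_mul]
    ring
  obtain ⟨n, hn⟩ := (hlim.eventually (lt_mem_nhds (sub_lt_self (∫ x, Hl x) hδ))).exists
  have hεn : (0 : ℝ) < 1 / ((n : ℝ) + 1) := Nat.one_div_pos_of_nat
  exact ⟨_, hpre _ hεn, by rw [← hHlv]; exact hn.le.trans (hlow _ hεn (hHint _ hεn))⟩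

/-- The lower bound of the total variation by the lengths of the shadows. -/
lemma sum_shadow_add_le (h : IsProfile ν N) {C : ℝ} (hC : FluxBound (fun p => (ν p : ℝ)) C)
    {B : Set ℝ} (hB : MeasurableSet B) (hB1 : B ⊆ Icc (-1) 1)
    {g : ℝ → ℝ} (hg : Measurable g) (hgb : ∃ C, ∀ z, |g z| ≤ C)
    (hgs : ∀ z, g z ≠ 0 → z ∈ Icc (-1 : ℝ) 1) (hgp : ∀ y, |(∫ z in Iic y, g z) - 1| ≤ 1)
    (hgt : ∫ z, g z = 2)
    (hgν : ∀ᵐ x, x ∈ B → 2 * (top ν N x : ℝ) + 2 ≤ ∫ z, (ν (x, z) : ℝ) * g z) :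
    ∑ j ∈ Finset.Icc 1 N, (volume.real (shadow (level ν j)) +
      volume.real (shadow (Prod.swap ⁻¹' level ν j))) + volume.real B ≤ C := by
  refine le_of_forall_pos_le_add fun δ hδ => ?_
  obtain ⟨κ, h1, h2⟩ := h.exists_preFlux hB hB1 hg hgb hgs hgp hgt hgν hδ
  obtain ⟨γ, h3, h4⟩ := h.swap.exists_preFlux (B := ∅) MeasurableSet.empty (empty_subset _)
    hg hgb hgs hgp hgt (by simp) hδ
  have h5 := hC.preFlux (fun p hp => h.support p (by exact_mod_cast hp)) h1 h3
  rw [Finset.sum_add_distrib]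
  have h6 : ∀ j, level (fun p => ν p.swap) j = Prod.swap ⁻¹' level ν j := fun j => rfl
  simp only [h6, measureReal_empty, add_zero] at h4
  linarith

end IsProfile

lemma exists_ae_eq_Ioo {A : Set ℝ} (hA1 : A ⊆ Ioo (-1) 1) (hA0 : volume A ≠ 0)
    (h : ∀ p q, p < q → volume (A ∩ Iio p) ≠ 0 → volume (A ∩ Ioi q) ≠ 0 →
      volume (Ioo p q \ A) = 0) :
    ∃ a b, a < b ∧ A =ᵐ[volume] Ioo a b := by
  set S := {p | volume (A ∩ Iio p) ≠ 0} with hS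
  set T := {q | volume (A ∩ Ioi q) ≠ 0} with hT
  have hS1 : (1 : ℝ) ∈ S := by
    have : A ∩ Iio 1 = A := inter_eq_left.2 fun x hx => (hA1 hx).2
    simpa [hS, this] using hA0
  have hT1 : (-1 : ℝ) ∈ T := by
    have : A ∩ Ioi (-1) = A := inter_eq_left.2 fun x hx => (hA1 hx).1
    simpa [hT, this] using hA0
  have hSb : BddBelow S := ⟨-1, fun p hp => by
    obtain ⟨x, hx⟩ := nonempty_of_measure_ne_zero hp
    exact ((hA1 hx.1).1.trans hx.2).le⟩
  have hTb : BddAbove T := ⟨1, fun p hp => by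
    obtain ⟨x, hx⟩ := nonempty_of_measure_ne_zero hp
    exact (lt_trans hx.2 (hA1 hx.1).2).le⟩
  set a := sInf S
  set b := sSup T
  have hSm : ∀ p, a < p → volume (A ∩ Iio p) ≠ 0 := fun p hp => by
    obtain ⟨p', h1, h2⟩ := (csInf_lt_iff hSb ⟨1, hS1⟩).1 hp
    exact fun h0 => h1 (measure_mono_null (inter_subset_inter_right _ (Iio_subset_Iio h2.le)) h0)
  have hTm : ∀ q, q < b → volume (A ∩ Ioi q) ≠ 0 := fun q hq => by
    obtain ⟨q', h1, h2⟩ := (lt_csSup_iff hTb ⟨-1, hT1⟩).1 hq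
    exact fun h0 => h1 (measure_mono_null (inter_subset_inter_right _ (Ioi_subset_Ioi h2.le)) h0)
  have hla : volume (A ∩ Iio a) = 0 := by
    have : A ∩ Iio a ⊆ ⋃ n : ℕ, A ∩ Iio (a - 1 / ((n : ℝ) + 1)) := fun x hx => by
      obtain ⟨n, hn⟩ := exists_nat_one_div_lt (sub_pos.2 (show x < a from hx.2))
      exact mem_iUnion.2 ⟨n, hx.1, show x < _ by linarith⟩
    refine measure_mono_null this (measure_iUnion_null fun n => ?_)
    by_contra hne
    have h1 := csInf_le hSb hne
    have h2 : (0 : ℝ) < 1 / ((n : ℝ) + 1) := Nat.one_div_pos_of_nat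
    change a ≤ _ at h1
    linarith
  have hub : volume (A ∩ Ioi b) = 0 := by
    have : A ∩ Ioi b ⊆ ⋃ n : ℕ, A ∩ Ioi (b + 1 / ((n : ℝ) + 1)) := fun x hx => by
      obtain ⟨n, hn⟩ := exists_nat_one_div_lt (sub_pos.2 (show b < x from hx.2))
      exact mem_iUnion.2 ⟨n, hx.1, show _ < x by linarith⟩
    refine measure_mono_null this (measure_iUnion_null fun n => ?_)
    by_contra hne
    have h1 := le_csSup hTb hne
    have h2 : (0 : ℝ) < 1 / ((n : ℝ) + 1) := Nat.one_div_pos_of_nat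
    change _ ≤ b at h1
    linarith
  have hmid : volume (Ioo a b \ A) = 0 := by
    have : Ioo a b \ A ⊆
        ⋃ n : ℕ, Ioo (a + 1 / ((n : ℝ) + 1)) (b - 1 / ((n : ℝ) + 1)) \ A := fun x hx => by
      obtain ⟨n, hn⟩ := exists_nat_one_div_lt
        (lt_min (sub_pos.2 (show a < x from hx.1.1)) (sub_pos.2 (show x < b from hx.1.2)))
      have h1 := lt_min_iff.1 hn
      exact mem_iUnion.2 ⟨n, ⟨by linarith, by linarith⟩, hx.2⟩
    refine measure_mono_null this (measure_iUnion_null fun n => ?_)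
    have h2 : (0 : ℝ) < 1 / ((n : ℝ) + 1) := Nat.one_div_pos_of_nat
    rcases lt_or_ge (a + 1 / ((n : ℝ) + 1)) (b - 1 / ((n : ℝ) + 1)) with h3 | h3
    · exact h _ _ h3 (hSm _ (by linarith)) (hTm _ (by linarith))
    · rw [Ioo_eq_empty (not_lt.2 h3)]; simp
  have hle : A ≤ᵐ[volume] Icc a b := by
    have : ∀ᵐ x, x ∈ A → x ∈ Icc a b := by
      filter_upwards [measure_eq_zero_iff_ae_notMem.1 hla, measure_eq_zero_iff_ae_notMem.1 hub]
        with x h1 h2 hx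
      exact ⟨not_lt.1 fun h' => h1 ⟨hx, h'⟩, not_lt.1 fun h' => h2 ⟨hx, h'⟩⟩
    exact this
  have hge : Ioo a b ≤ᵐ[volume] A := by
    have : ∀ᵐ x, x ∈ Ioo a b → x ∈ A := by
      filter_upwards [measure_eq_zero_iff_ae_notMem.1 hmid] with x h1 hx
      exact by_contra fun h' => h1 ⟨hx, h'⟩
    exact this
  have hA : A =ᵐ[volume] Ioo a b := (hle.trans Ioo_ae_eq_Icc.symm.le).antisymm hge
  refine ⟨a, b, ?_, hA⟩
  by_contra hab
  rw [measure_congr hA, Ioo_eq_empty hab, measure_empty] at hA0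
  exact hA0 rfl

lemma integral_normalized {s : Set ℝ} (hs : MeasurableSet s) (h0 : volume s ≠ 0)
    (h1 : volume s ≠ ⊤) :
    Integrable (s.indicator fun _ => 1 / volume.real s) ∧
      ∫ z, s.indicator (fun _ => 1 / volume.real s) z = 1 := by
  refine ⟨(integrable_indicator_iff hs).2 (integrableOn_const h1), ?_⟩
  rw [integral_indicator hs, setIntegral_const, smul_eq_mul, mul_one_div]
  exact div_self (ENNReal.toReal_pos h0 h1).ne'

namespace IsProfile
variable {ν : ℝ × ℝ → ℕ} {N : ℕ} {C : ℝ}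

lemma sum_shadow_le (h : IsProfile ν N) (hC : FluxBound (fun p => (ν p : ℝ)) C) :
    ∑ j ∈ Finset.Icc 1 N, (volume.real (shadow (level ν j)) +
      volume.real (shadow (Prod.swap ⁻¹' level ν j))) ≤ C := by
  set g : ℝ → ℝ := (Icc (-1) 1).indicator 1 with hg
  have hgi : Integrable g :=
    (integrable_indicator_iff measurableSet_Icc).2 (integrableOn_const (by simp))
  have hg0 : ∀ z, 0 ≤ g z := fun z => indicator_nonneg (fun _ _ => zero_le_one) z
  have hgt : ∫ z, g z = 2 := by
    rw [hg, integral_indicator_one measurableSet_Icc, Real.volume_real_Icc_of_le] <;> norm_num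
  have := h.sum_shadow_add_le hC (B := ∅) MeasurableSet.empty (empty_subset _) (g := g)
    (measurable_one.indicator measurableSet_Icc)
    ⟨1, fun z => by
      rw [abs_of_nonneg (hg0 z)]; exact indicator_le_self' (fun _ _ => zero_le_one) z⟩
    (fun z hz => mem_of_indicator_ne_zero hz)
    (fun y => by
      have h1 := setIntegral_nonneg (μ := volume) (measurableSet_Iic (a := y)) fun z _ => hg0 z
      have h2 := setIntegral_le_integral (s := Iic y) hgi (Eventually.of_forall hg0)
      rw [abs_le]
      constructor <;> linarith)
    hgt (by simp)
  simpa using this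

/-- If the lower bound by the shadows is attained and the top level is a product, then the vertical
factor is an interval. -/
lemma shadow_swap_ae_eq_Ioo (h : IsProfile ν N) (hN : 1 ≤ N)
    (hC : FluxBound (fun p => (ν p : ℝ)) C)
    (hle : C ≤ ∑ j ∈ Finset.Icc 1 N, (volume.real (shadow (level ν j)) +
      volume.real (shadow (Prod.swap ⁻¹' level ν j))))
    (hprod : level ν N =ᵐ[volume] shadow (level ν N) ×ˢ shadow (Prod.swap ⁻¹' level ν N))
    (h1 : volume (shadow (level ν N)) ≠ 0) (h2 : volume (shadow (Prod.swap ⁻¹' level ν N)) ≠ 0) :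
    ∃ a b, a < b ∧ shadow (Prod.swap ⁻¹' level ν N) =ᵐ[volume] Ioo a b := by
  have hE := h.measurableSet_level N
  have hD := h.level_subset hN
  set B := shadow (level ν N) with hB
  set A := shadow (Prod.swap ⁻¹' level ν N) with hA
  have hBm : MeasurableSet B := measurableSet_shadow hE
  have hAm : MeasurableSet A := measurableSet_shadow (measurableSet_swap hE)
  have hA1 : A ⊆ Ioo (-1) 1 := shadow_subset (swap_subset_diamond hD)
  have hAt : volume A ≠ ⊤ := volume_shadow_ne_top (swap_subset_diamond hD)
  refine exists_ae_eq_Ioo hA1 h2 fun p q hpq hp hq => ?_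
  by_contra hpq0
  set s₁ := A ∩ Iio p with hs₁
  set s₂ := Ioo p q \ A with hs₂
  set s₃ := A ∩ Ioi q with hs₃
  have hm₁ : MeasurableSet s₁ := hAm.inter measurableSet_Iio
  have hm₂ : MeasurableSet s₂ := measurableSet_Ioo.diff hAm
  have hm₃ : MeasurableSet s₃ := hAm.inter measurableSet_Ioi
  have ht₁ : volume s₁ ≠ ⊤ := ((measure_mono inter_subset_left).trans_lt hAt.lt_top).ne
  have ht₂ : volume s₂ ≠ ⊤ := ((measure_mono sdiff_subset).trans_lt measure_Ioo_lt_top).ne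
  have ht₃ : volume s₃ ≠ ⊤ := ((measure_mono inter_subset_left).trans_lt hAt.lt_top).ne
  set k₁ : ℝ → ℝ := s₁.indicator fun _ => 1 / volume.real s₁ with hk₁
  set k₂ : ℝ → ℝ := s₂.indicator fun _ => 1 / volume.real s₂ with hk₂
  set k₃ : ℝ → ℝ := s₃.indicator fun _ => 1 / volume.real s₃ with hk₃
  obtain ⟨hi₁, hv₁⟩ : Integrable k₁ ∧ ∫ z, k₁ z = 1 :=
    integral_normalized hm₁ hp ht₁
  obtain ⟨hi₂, hv₂⟩ : Integrable k₂ ∧ ∫ z, k₂ z = 1 :=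
    integral_normalized hm₂ hpq0 ht₂
  obtain ⟨hi₃, hv₃⟩ : Integrable k₃ ∧ ∫ z, k₃ z = 1 :=
    integral_normalized hm₃ hq ht₃
  have hnn : ∀ s : Set ℝ, ∀ z, 0 ≤ s.indicator (fun _ => 1 / volume.real s) z ∧
      s.indicator (fun _ => 1 / volume.real s) z ≤ 1 / volume.real s := fun s z =>
    ⟨indicator_nonneg (fun _ _ => by positivity) z,
      indicator_le_self' (fun _ _ => by positivity) z⟩
  have hi₁₂ : Integrable fun z => k₁ z - k₂ z := hi₁.sub hi₂
  set g : ℝ → ℝ := fun z => 2 * (k₁ z - k₂ z + k₃ z) with hg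
  have hgi : Integrable g := (hi₁₂.add hi₃).const_mul 2
  have hgint : ∀ y, ∫ z in Iic y, g z =
      2 * ((∫ z in Iic y, k₁ z) - (∫ z in Iic y, k₂ z) + ∫ z in Iic y, k₃ z) := fun y => by
    simp only [hg]
    rw [integral_const_mul, integral_add hi₁₂.integrableOn hi₃.integrableOn,
      integral_sub hi₁.integrableOn hi₂.integrableOn]
  have hgt : ∫ z, g z = 2 := by
    simp only [hg]
    rw [integral_const_mul, integral_add hi₁₂ hi₃, integral_sub hi₁ hi₂, hv₁, hv₂, hv₃]
    norm_num
  obtain ⟨x₁, hx₁⟩ := nonempty_of_measure_ne_zero hp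
  obtain ⟨x₃, hx₃⟩ := nonempty_of_measure_ne_zero hq
  have hp1 : -1 < p := (hA1 hx₁.1).1.trans hx₁.2
  have hq1 : q < 1 := lt_trans hx₃.2 (hA1 hx₃.1).2
  have hle' := h.sum_shadow_add_le hC hBm ((shadow_subset hD).trans Ioo_subset_Icc_self) (g := g)
    ?_ ?_ ?_ ?_ hgt ?_
  · have := ENNReal.toReal_pos h1 (volume_shadow_ne_top hD)
    change 0 < volume.real B at this
    linarith
  · exact (((measurable_const.indicator hm₁).sub (measurable_const.indicator hm₂)).add
      (measurable_const.indicator hm₃)).const_mul 2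
  · refine ⟨2 * (1 / volume.real s₁ + 1 / volume.real s₂ + 1 / volume.real s₃), fun z => ?_⟩
    have e1 := hnn s₁ z
    have e2 := hnn s₂ z
    have e3 := hnn s₃ z
    simp only [hg, hk₁, hk₂, hk₃]
    rw [abs_le]
    constructor <;> linarith
  · intro z hz
    by_contra hzI
    refine hz ?_
    have e1 : k₁ z = 0 := indicator_of_notMem (fun h' => hzI (Ioo_subset_Icc_self (hA1 h'.1))) _
    have e2 : k₂ z = 0 := indicator_of_notMem
      (fun h' => hzI ⟨by linarith [h'.1.1], by linarith [h'.1.2]⟩) _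
    have e3 : k₃ z = 0 := indicator_of_notMem (fun h' => hzI (Ioo_subset_Icc_self (hA1 h'.1))) _
    simp only [hg, e1, e2, e3]; norm_num
  · intro y
    have hb : ∀ s : Set ℝ, Integrable (s.indicator fun _ => 1 / volume.real s) →
        ∫ z, s.indicator (fun _ => 1 / volume.real s) z = 1 →
        0 ≤ (∫ z in Iic y, s.indicator (fun _ => 1 / volume.real s) z) ∧
        (∫ z in Iic y, s.indicator (fun _ => 1 / volume.real s) z) ≤ 1 := fun s hi hv =>
      ⟨setIntegral_nonneg measurableSet_Iic fun z _ => (hnn s z).1, by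
        exact (setIntegral_le_integral hi (Eventually.of_forall fun z => (hnn s z).1)).trans hv.le⟩
    have b1 := hb s₁ hi₁ hv₁
    have b2 := hb s₂ hi₂ hv₂
    have b3 := hb s₃ hi₃ hv₃
    have z2 : y ≤ p → ∫ z in Iic y, k₂ z = 0 := fun hy =>
      setIntegral_eq_zero_of_forall_eq_zero fun z (hz : z ≤ y) =>
        indicator_of_notMem (fun h' => by linarith [h'.1.1]) _
    have z3 : y ≤ q → ∫ z in Iic y, k₃ z = 0 := fun hy =>
      setIntegral_eq_zero_of_forall_eq_zero fun z (hz : z ≤ y) =>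
        indicator_of_notMem (fun h' => by
          have : q < z := h'.2
          linarith) _
    have o1 : p ≤ y → ∫ z in Iic y, k₁ z = 1 := fun hy => by
      rw [← hv₁]
      refine setIntegral_eq_integral_of_forall_compl_eq_zero fun z hz => ?_
      exact indicator_of_notMem (fun h' => hz (le_trans (le_of_lt h'.2) hy)) _
    have o2 : q ≤ y → ∫ z in Iic y, k₂ z = 1 := fun hy => by
      rw [← hv₂]
      refine setIntegral_eq_integral_of_forall_compl_eq_zero fun z hz => ?_
      exact indicator_of_notMem (fun h' => hz (le_trans h'.1.2.le hy)) _
    rw [hgint, abs_le]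
    rcases le_total y p with hy | hy
    · rw [z2 hy, z3 (hy.trans hpq.le)]
      constructor <;> linarith
    · rw [o1 hy]
      rcases le_total y q with hy' | hy'
      · rw [z3 hy']
        constructor <;> linarith
      · rw [o2 hy']
        constructor <;> linarith
  · have hprod' : ∀ᵐ r : ℝ × ℝ, r ∈ level ν N ↔ r ∈ B ×ˢ A := hprod.mem_iff
    rw [Measure.volume_eq_prod] at hprod'
    filter_upwards [Measure.ae_ae_of_ae_prod hprod'] with x hx hxB
    have htop : top ν N x = N :=
      le_antisymm (top_le ν N x) ((mem_shadow_iff hN le_rfl).1 hxB)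
    rw [htop]
    have hνg : Integrable fun z => (ν (x, z) : ℝ) * g z := by
      have hνm : Measurable fun p => (ν p : ℝ) := measurable_from_top.comp h.measurable
      exact hgi.bdd_mul (hνm.comp measurable_prodMk_left).aestronglyMeasurable (c := N) <|
        Eventually.of_forall fun z => by simpa using h.le (x, z)
    have hlow : ∫ z, ((N : ℝ) * g z + 2 * k₂ z) = 2 * N + 2 := by
      rw [integral_add (hgi.const_mul _) (hi₂.const_mul _), integral_const_mul (N : ℝ) g,
        integral_const_mul 2 k₂, hgt, hv₂]
      ring
    rw [← hlow]
    refine integral_mono_ae ((hgi.const_mul _).add (hi₂.const_mul _)) hνg ?_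
    filter_upwards [hx] with z hz
    have hz' : N ≤ ν (x, z) ↔ z ∈ A := by
      have h3 : (x, z) ∈ level ν N ↔ N ≤ ν (x, z) := Iff.rfl
      rw [← h3, hz]
      simp [hxB]
    by_cases hzA : z ∈ A
    · have e2 : k₂ z = 0 := indicator_of_notMem (fun h' => h'.2 hzA) _
      have e4 : ν (x, z) = N := le_antisymm (h.le _) (hz'.2 hzA)
      rw [e2, e4]; simp
    · have e1 : k₁ z = 0 := indicator_of_notMem (fun h' => hzA h'.1) _
      have e3 : k₃ z = 0 := indicator_of_notMem (fun h' => hzA h'.1) _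
      have e4 : (ν (x, z) : ℝ) + 1 ≤ N := by
        have : ν (x, z) < N := not_le.1 (mt hz'.1 hzA)
        exact_mod_cast this
      have e5 : 0 ≤ k₂ z := (hnn s₂ z).1
      simp only [hg, e1, e3]
      nlinarith

/-- If the lower bound by the shadows is attained and the top level attains the isoperimetric
inequality, then it is a square. -/
lemma exists_level_ae_eq_square (h : IsProfile ν N) (hN : 1 ≤ N)
    (hC : FluxBound (fun p => (ν p : ℝ)) C)
    (hle : C ≤ ∑ j ∈ Finset.Icc 1 N, (volume.real (shadow (level ν j)) +
      volume.real (shadow (Prod.swap ⁻¹' level ν j))))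
    (hpos : 0 < volume.real (level ν N))
    (hiso : volume.real (shadow (level ν N)) + volume.real (shadow (Prod.swap ⁻¹' level ν N)) ≤
      2 * √(volume.real (level ν N))) :
    ∃ s t, level ν N =ᵐ[volume]
      Ioo (s - √(volume.real (level ν N)) / 2) (s + √(volume.real (level ν N)) / 2) ×ˢ
      Ioo (t - √(volume.real (level ν N)) / 2) (t + √(volume.real (level ν N)) / 2) := by
  have hE := h.measurableSet_level N
  have hD := h.level_subset hN
  obtain ⟨hα, hβ, hprod⟩ := of_shadow_eq_two_sqrt hE hD hiso
  have hr : 0 < √(volume.real (level ν N)) := Real.sqrt_pos.2 hpos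
  have h1 : volume (shadow (level ν N)) ≠ 0 := fun h0 => by
    rw [measureReal_def, h0] at hα; simp at hα; linarith
  have h2 : volume (shadow (Prod.swap ⁻¹' level ν N)) ≠ 0 := fun h0 => by
    rw [measureReal_def, h0] at hβ; simp at hβ; linarith
  obtain ⟨c, d, hcd, hA⟩ := h.shadow_swap_ae_eq_Ioo hN hC hle hprod h1 h2
  have hl : ∀ j, level (fun p => ν p.swap) j = Prod.swap ⁻¹' level ν j := fun j => rfl
  have hss : ∀ E : Set (ℝ × ℝ), Prod.swap ⁻¹' (Prod.swap ⁻¹' E) = E := fun E => by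
    ext p; simp
  obtain ⟨a, b, hab, hB⟩ := h.swap.shadow_swap_ae_eq_Ioo hN hC.swap
    (by simpa only [hl, hss, add_comm] using hle)
    (by
      rw [hl, hss]
      have := ae_swap hprod.mem_iff
      refine eventuallyEq_set.2 ?_
      filter_upwards [this] with p hp
      exact hp.trans ⟨fun h => ⟨h.2, h.1⟩, fun h => ⟨h.2, h.1⟩⟩)
    (by rwa [hl]) (by rwa [hl, hss])
  rw [hl, hss] at hB
  rw [measureReal_congr hA, Real.volume_real_Ioo_of_le hcd.le] at hβ
  rw [measureReal_congr hB, Real.volume_real_Ioo_of_le hab.le] at hα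
  refine ⟨(a + b) / 2, (c + d) / 2, hprod.trans ?_⟩
  rw [← hα, show (a + b) / 2 - (b - a) / 2 = a by ring, show (a + b) / 2 + (b - a) / 2 = b by ring,
    show (c + d) / 2 - (b - a) / 2 = c by linarith, show (c + d) / 2 + (b - a) / 2 = d by linarith]
  have e1 : ∀ᵐ p : ℝ × ℝ, p.1 ∈ shadow (level ν N) ↔ p.1 ∈ Ioo a b := by
    rw [Measure.volume_eq_prod]
    exact Measure.quasiMeasurePreserving_fst.ae hB.mem_iff
  have e2 : ∀ᵐ p : ℝ × ℝ, p.2 ∈ shadow (Prod.swap ⁻¹' level ν N) ↔ p.2 ∈ Ioo c d := by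
    rw [Measure.volume_eq_prod]
    exact Measure.quasiMeasurePreserving_snd.ae hA.mem_iff
  refine eventuallyEq_set.2 ?_
  filter_upwards [e1, e2] with p h1 h2
  simp only [mem_prod, h1, h2]

end IsProfile

lemma sqrt_add_lt {x y : ℝ} (hx : 0 < x) (hy : 0 < y) : √(x + y) < √x + √y := by
  rw [Real.sqrt_lt' (by positivity)]
  nlinarith [Real.sq_sqrt hx.le, Real.sq_sqrt hy.le,
    mul_pos (Real.sqrt_pos.2 hx) (Real.sqrt_pos.2 hy)]

lemma sqrt_sum_le_sum_sqrt {ι : Type*} (s : Finset ι) {a : ι → ℝ} (ha : ∀ i ∈ s, 0 ≤ a i) :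
    √(∑ i ∈ s, a i) ≤ ∑ i ∈ s, √(a i) := by
  classical
  induction s using Finset.induction_on with
  | empty => simp
  | insert i s hi ih =>
    rw [Finset.sum_insert hi, Finset.sum_insert hi]
    have h0 := ha i (Finset.mem_insert_self i s)
    have hs : ∀ k ∈ s, 0 ≤ a k := fun k hk => ha k (Finset.mem_insert_of_mem hk)
    have h1 : 0 ≤ ∑ k ∈ s, a k := Finset.sum_nonneg hs
    refine Real.sqrt_le_iff.2 ⟨by positivity, ?_⟩
    nlinarith [Real.sq_sqrt h0, Real.sq_sqrt h1, ih hs, Real.sqrt_nonneg (a i),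
      Real.sqrt_nonneg (∑ k ∈ s, a k)]

lemma sqrt_sum_lt_sum_sqrt {ι : Type*} {s : Finset ι} {a : ι → ℝ} (ha : ∀ i ∈ s, 0 < a i)
    {i k : ι} (hi : i ∈ s) (hk : k ∈ s) (hik : i ≠ k) :
    √(∑ i ∈ s, a i) < ∑ i ∈ s, √(a i) := by
  classical
  rw [← Finset.add_sum_erase s _ hi, ← Finset.add_sum_erase s (fun i => √(a i)) hi]
  have hpos : ∀ l ∈ s.erase i, 0 < a l := fun l hl => ha l (Finset.mem_of_mem_erase hl)
  refine (sqrt_add_lt (ha i hi) (Finset.sum_pos hpos ⟨k, ?_⟩)).trans_le ?_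
  · exact Finset.mem_erase.2 ⟨hik.symm, hk⟩
  · gcongr
    exact sqrt_sum_le_sum_sqrt _ fun l hl => (hpos l hl).le

section arithmetic
variable {A S : ℕ → ℝ} {N : ℕ}

lemma eq_one_of_sum_le_sqrt (hN : 1 ≤ N) (hA : ∀ j ∈ Finset.Icc 1 N, 0 < A j)
    (hS : ∀ j ∈ Finset.Icc 1 N, 2 * √(A j) ≤ S j)
    (h : ∑ j ∈ Finset.Icc 1 N, S j ≤ 2 * √(∑ j ∈ Finset.Icc 1 N, A j)) : N = 1 := by
  by_contra h1
  have hlt := sqrt_sum_lt_sum_sqrt hA (i := 1) (k := 2) (by simp; omega) (by simp; omega) (by simp)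
  have := Finset.sum_le_sum hS
  rw [← Finset.mul_sum] at this
  linarith

lemma cases_of_sum_le (hN : 1 ≤ N) (hA : ∀ j ∈ Finset.Icc 1 N, 0 < A j)
    (hA1 : ∀ j ∈ Finset.Icc 1 N, A j ≤ A 1)
    (hS : ∀ j ∈ Finset.Icc 1 N, 2 * √(A j) ≤ S j) (hS1 : 1 ≤ A 1 → 4 - 2 * √(2 - A 1) ≤ S 1)
    {M : ℝ} (hM : ∑ j ∈ Finset.Icc 1 N, A j = M) (hM1 : 1 ≤ M) (hM2 : M ≤ 2)
    (h : ∑ j ∈ Finset.Icc 1 N, S j ≤ 4 - 2 * √(2 - M)) :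
    1 ≤ A 1 ∧ (N = 1 ∨
      (N = 2 ∧ M = 2 ∧ S 1 ≤ 4 - 2 * √(2 - A 1) ∧ S 2 ≤ 2 * √(A 2))) := by
  have hA11 : 1 ≤ A 1 := by
    by_contra! hlt
    have h1 : ∀ j ∈ Finset.Icc 1 N, 2 * A j < S j := fun j hj => by
      have hj0 := hA j hj
      have : A j < √(A j) := Real.lt_sqrt_of_sq_lt (by nlinarith [hA1 j hj])
      linarith [hS j hj]
    have h2 := Finset.sum_lt_sum_of_nonempty (by simpa using hN) h1
    rw [← Finset.mul_sum, hM] at h2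
    have : 2 - M ≤ √(2 - M) := Real.le_sqrt_of_sq_le (by nlinarith)
    linarith
  refine ⟨hA11, or_iff_not_imp_left.2 fun hN1 => ?_⟩
  have hins : Finset.Icc 1 N = insert 1 (Finset.Icc 2 N) := by
    ext j; simp only [Finset.mem_Icc, Finset.mem_insert]; omega
  have hnot : (1 : ℕ) ∉ Finset.Icc 2 N := by simp
  have hsub : ∀ j ∈ Finset.Icc 2 N, j ∈ Finset.Icc 1 N := fun j hj => by
    simp only [Finset.mem_Icc] at hj ⊢; omega
  rw [hins, Finset.sum_insert hnot] at hM h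
  set q := ∑ j ∈ Finset.Icc 2 N, A j with hq
  have hq0 : 0 < q := Finset.sum_pos (fun j hj => hA j (hsub j hj)) ⟨2, by simp; omega⟩
  have hS2 := Finset.sum_le_sum fun j hj => hS j (hsub j hj)
  rw [← Finset.mul_sum] at hS2
  have hsq : √q ≤ ∑ j ∈ Finset.Icc 2 N, √(A j) :=
    sqrt_sum_le_sum_sqrt _ fun j hj => (hA j (hsub j hj)).le
  have hM2' : M = 2 := by
    by_contra hne
    have := sqrt_add_lt hq0 (show 0 < 2 - M from sub_pos.2 (lt_of_le_of_ne hM2 hne))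
    rw [show q + (2 - M) = 2 - A 1 by linarith] at this
    linarith [hS1 hA11]
  have hqe : q = 2 - A 1 := by linarith
  rw [hM2', sub_self, Real.sqrt_zero] at h
  have hN2 : N = 2 := by
    by_contra hne
    have := sqrt_sum_lt_sum_sqrt (s := Finset.Icc 2 N) (fun j hj => hA j (hsub j hj))
      (i := 2) (k := 3) (by simp; omega) (by simp; omega) (by simp)
    rw [← hq, hqe] at this
    linarith [hS1 hA11]
  subst hN2
  simp only [Finset.Icc_self, Finset.sum_singleton] at hq h hS2
  rw [hqe] at hsq hq
  rw [← hq] at hS2 ⊢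
  exact ⟨rfl, hM2', by linarith [hS 2 (by simp)], by linarith [hS1 hA11]⟩

end arithmetic

namespace IsProfile
variable {ν : ℝ × ℝ → ℕ} {N : ℕ}

lemma sum_indicator_level (h : IsProfile ν N) (p : ℝ × ℝ) :
    ∑ j ∈ Finset.Icc 1 N, (level ν j).indicator (fun _ => (1 : ℝ)) p = ν p := by
  classical
  have : ∀ j ∈ Finset.Icc 1 N, (level ν j).indicator (fun _ => (1 : ℝ)) p
      = if j ≤ ν p then 1 else 0 := fun j _ => by
    by_cases hj : j ≤ ν p <;> simp [level, hj]
  rw [Finset.sum_congr rfl this, Finset.sum_boole]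
  have : Finset.filter (fun j => j ≤ ν p) (Finset.Icc 1 N) = Finset.Icc 1 (ν p) := by
    ext j
    have := h.le p
    simp only [Finset.mem_filter, Finset.mem_Icc]
    omega
  rw [this]
  simp

lemma integral_eq_sum (h : IsProfile ν N) :
    ∫ p, (ν p : ℝ) = ∑ j ∈ Finset.Icc 1 N, volume.real (level ν j) := by
  have hi : ∀ j ∈ Finset.Icc 1 N,
      Integrable ((level ν j).indicator fun _ => (1 : ℝ)) := fun j hj =>
    (integrable_indicator_iff (h.measurableSet_level j)).2
      (integrableOn_const (volume_ne_top (h.level_subset (Finset.mem_Icc.1 hj).1)))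
  simp only [← h.sum_indicator_level]
  rw [integral_finsetSum _ hi]
  exact Finset.sum_congr rfl fun j _ => integral_indicator_one (h.measurableSet_level j)

lemma volume_real_level_le (h : IsProfile ν N) {i j : ℕ} (hi : 1 ≤ i) (hij : i ≤ j) :
    volume.real (level ν j) ≤ volume.real (level ν i) :=
  measureReal_mono (level_antitone hij) (volume_ne_top (h.level_subset hi))

end IsProfile

lemma unitSquare_eq : unitSquare = ofPlane ⁻¹' diamond := by
  ext x
  simp only [unitSquare, mem_univ_pi, Fin.forall_fin_two, mem_Ioo, diamond, ofPlane, mem_preimage,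
    mem_ofPred_eq]
  constructor
  · rintro ⟨⟨h1, h2⟩, h3, h4⟩
    cases abs_cases (x 0 + x 1 - 1) <;> cases abs_cases (x 0 - x 1) <;> linarith
  · intro h
    have h1 := le_abs_self (x 0 + x 1 - 1)
    have h2 := neg_abs_le (x 0 + x 1 - 1)
    have h3 := le_abs_self (x 0 - x 1)
    have h4 := neg_abs_le (x 0 - x 1)
    refine ⟨⟨?_, ?_⟩, ?_, ?_⟩ <;> linarith

lemma wulffBall_crysNorm (x : Fin 2 → ℝ) (r : ℝ) :
    wulffBall crysNorm x r = ofPlane ⁻¹' (Ioo ((ofPlane x).1 - r) ((ofPlane x).1 + r) ×ˢ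
      Ioo ((ofPlane x).2 - r) ((ofPlane x).2 + r)) := by
  ext y
  simp only [wulffBall, mem_ofPred_eq, crysNorm_eq_max, max_lt_iff, abs_lt, ofPlane, mem_preimage,
    mem_prod, mem_Ioo, Pi.sub_apply]
  constructor <;> rintro ⟨⟨h1, h2⟩, h3, h4⟩ <;> refine ⟨⟨?_, ?_⟩, ?_, ?_⟩ <;> linarith

lemma wulffBall_subset_unitSquare {x : Fin 2 → ℝ} {r : ℝ} (hr : 0 < r) :
    wulffBall crysNorm x r ⊆ unitSquare ↔ ∀ i, x i ∈ Icc r (1 - r) := by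
  constructor
  · intro h i
    have key : ∀ a : ℝ, |a| < r → x i + a ∈ Ioo (0 : ℝ) 1 := fun a ha => by
      have : x + Pi.single i a ∈ wulffBall crysNorm x r := by
        fin_cases i <;> simpa [wulffBall, crysNorm] using ha
      simpa using h this i (mem_univ i)
    constructor
    · refine le_of_forall_lt fun a ha => ?_
      have h1 : |-(max a 0)| < r := by
        rw [abs_neg, abs_of_nonneg (le_max_right _ _)]
        exact max_lt ha hr
      linarith [(key _ h1).1, le_max_left a 0]
    · have : r ≤ 1 - x i := by
        refine le_of_forall_lt fun a ha => ?_
        have h1 : |max a 0| < r := by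
          rw [abs_of_nonneg (le_max_right _ _)]
          exact max_lt ha hr
        linarith [(key _ h1).2, le_max_left a 0]
      linarith
  · intro h y hy i _
    have hi := h i
    have h1 : |y 0 - x 0| + |y 1 - x 1| < r := hy
    have h2 : |y i - x i| < r := by
      fin_cases i
      · exact (le_add_of_nonneg_right (abs_nonneg _)).trans_lt h1
      · exact (le_add_of_nonneg_left (abs_nonneg _)).trans_lt h1
    rw [abs_lt] at h2
    exact ⟨by linarith [hi.1], by linarith [hi.2]⟩

lemma plaquette_unitSquare {r : ℝ} (hr : 0 < r) (hr2 : r ≤ 1 / 2) :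
    plaquette crysNorm unitSquare r = ofPlane ⁻¹' octagon (1 - r) := by
  ext y
  rw [plaquette, if_neg hr.ne']
  simp only [mem_iUnion, exists_prop]
  constructor
  · rintro ⟨x, hx, hy⟩
    have hd : ofPlane y ∈ diamond := by
      have := hx hy
      rwa [unitSquare_eq] at this
    rw [wulffBall_subset_unitSquare hr] at hx
    obtain ⟨h0, h0'⟩ := hx 0
    obtain ⟨h1, h1'⟩ := hx 1
    rw [wulffBall_crysNorm] at hy
    obtain ⟨⟨h2, h3⟩, h4, h5⟩ := hy
    simp only [ofPlane] at h2 h3 h4 h5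
    refine ⟨?_, ?_, hd⟩ <;> simp only [ofPlane, abs_lt] <;> constructor <;> linarith
  · rintro ⟨h1, h2, h3⟩
    have hy : y ∈ unitSquare := by rwa [unitSquare_eq]
    obtain ⟨h4, h5⟩ := hy 0 (mem_univ _)
    obtain ⟨h6, h7⟩ := hy 1 (mem_univ _)
    simp only [ofPlane, abs_lt] at h1 h2
    refine ⟨fun i => max r (min (1 - r) (y i)), ?_, ?_⟩
    · rw [wulffBall_subset_unitSquare hr]
      exact fun i => ⟨le_max_left _ _, max_le (by linarith) (min_le_left _ _)⟩
    · have key : ∀ z : ℝ, (z ≤ r ∧ |z - max r (min (1 - r) z)| = r - z) ∨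
          (r ≤ z ∧ z ≤ 1 - r ∧ |z - max r (min (1 - r) z)| = 0) ∨
          (1 - r ≤ z ∧ |z - max r (min (1 - r) z)| = z - (1 - r)) := fun z => by
        rcases le_total z r with h | h
        · left
          rw [max_eq_left ((min_le_right _ _).trans h), abs_of_nonpos (by linarith)]
          exact ⟨h, by ring⟩
        rcases le_total z (1 - r) with h' | h'
        · right; left
          rw [min_eq_right h', max_eq_right h]
          simp [h, h']
        · right; right
          rw [min_eq_left h', max_eq_right (by linarith), abs_of_nonneg (by linarith)]
          exact ⟨h', rfl⟩
      change |y 0 - max r (min (1 - r) (y 0))| + |y 1 - max r (min (1 - r) (y 1))| < r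
      rcases key (y 0) with ⟨a1, e1⟩ | ⟨a1, a2, e1⟩ | ⟨a1, e1⟩ <;>
      rcases key (y 1) with ⟨b1, e2⟩ | ⟨b1, b2, e2⟩ | ⟨b1, e2⟩ <;>
      rw [e1, e2] <;> linarith [h1.1, h1.2, h2.1, h2.2]

lemma closure_unitSquare : closure unitSquare = closedUnitSquare := by
  simp [unitSquare, closedUnitSquare, closure_pi_set]

lemma closure_densityPoints_of_ae_eq {n : ℕ} {A S : Set (Fin n → ℝ)} (hS : IsOpen S)
    (h : A =ᵐ[volume] S) : closure (densityPoints A) = closure S := by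
  have hA : ∀ x r, volume (A ∩ Metric.ball x r) = volume (S ∩ Metric.ball x r) := fun x r =>
    measure_congr (h.inter (ae_eq_refl _))
  apply subset_antisymm
  · refine closure_minimal (fun x hx => ?_) isClosed_closure
    by_contra hxS
    obtain ⟨ε, hε, hball⟩ := Metric.isOpen_iff.1 isClosed_closure.isOpen_compl x hxS
    have h0 : Tendsto (fun r : ℝ => volume (A ∩ Metric.ball x r) / volume (Metric.ball x r))
        (nhdsWithin 0 (Ioi 0)) (nhds 0) := by
      refine tendsto_const_nhds.congr' ?_
      filter_upwards [Ioo_mem_nhdsGT hε] with r hr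
      have : S ∩ Metric.ball x r = ∅ := by
        refine disjoint_iff_inter_eq_empty.1 (disjoint_left.2 fun y hy hy' => ?_)
        exact hball (Metric.ball_subset_ball hr.2.le hy') (subset_closure hy)
      rw [hA, this, measure_empty, ENNReal.zero_div]
    exact zero_ne_one (tendsto_nhds_unique h0 hx)
  · refine closure_mono fun x hx => ?_
    obtain ⟨ε, hε, hball⟩ := Metric.isOpen_iff.1 hS x hx
    refine tendsto_const_nhds.congr' ?_
    filter_upwards [Ioo_mem_nhdsGT hε] with r hr
    rw [hA, inter_eq_right.2 ((Metric.ball_subset_ball hr.2.le).trans hball),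
      ENNReal.div_self (Metric.measure_ball_pos _ _ hr.1).ne' measure_ball_lt_top.ne]

lemma closure_subset_closure_of_ae_le {α : Type*} [TopologicalSpace α] [MeasurableSpace α]
    {μ : Measure α} [μ.IsOpenPosMeasure] {U V : Set α} (hU : IsOpen U) (h : U ≤ᵐ[μ] V) :
    closure U ⊆ closure V := by
  refine closure_minimal (fun x hx => ?_) isClosed_closure
  by_contra hxV
  have h0 : μ (U ∩ (closure V)ᶜ) = 0 :=
    measure_mono_null (inter_subset_inter_right _ (compl_subset_compl.2 subset_closure))
      (ae_le_set.1 h)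
  have := ((hU.inter isClosed_closure.isOpen_compl).measure_eq_zero_iff μ).1 h0
  exact (this ▸ (⟨hx, hxV⟩ : x ∈ U ∩ (closure V)ᶜ) : x ∈ (∅ : Set α))

lemma ae_of_ae_ofPlane {P : ℝ × ℝ → Prop} (h : ∀ᵐ p, P p) : ∀ᵐ x : Fin 2 → ℝ, P (ofPlane x) := by
  rw [← ae_toPlane_iff]
  simpa using h

lemma closure_wulffBall_subset {s t r : ℝ} {E : Set (ℝ × ℝ)} (hE : E ⊆ diamond)
    (h : E =ᵐ[volume] Ioo (s - r) (s + r) ×ˢ Ioo (t - r) (t + r)) :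
    closure (wulffBall crysNorm (toPlane (s, t)) r) ⊆ closure unitSquare := by
  rw [wulffBall_crysNorm, unitSquare_eq, ofPlane_toPlane]
  refine closure_subset_closure_of_ae_le (μ := volume)
    ((isOpen_Ioo.prod isOpen_Ioo).preimage continuous_ofPlane) ?_
  exact ae_of_ae_ofPlane
    (P := fun p => p ∈ Ioo (s - r) (s + r) ×ˢ Ioo (t - r) (t + r) → p ∈ diamond)
    (h.symm.le.trans hE.eventuallyLE)

lemma closure_densityPoints_level {u : (Fin 2 → ℝ) → ℝ} {ν : ℝ × ℝ → ℕ}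
    (hν : ∀ᵐ p, u (toPlane p) = ν p) {j : ℕ} {T : Set (ℝ × ℝ)} (hT : IsOpen T)
    (h : level ν j =ᵐ[volume] T) :
    closure (densityPoints {x | (j : ℝ) ≤ u x}) = closure (ofPlane ⁻¹' T) := by
  refine closure_densityPoints_of_ae_eq (hT.preimage continuous_ofPlane) ?_
  rw [eventuallyEq_set]
  filter_upwards [ae_of_ae_ofPlane hν, ae_of_ae_ofPlane (eventuallyEq_set.1 h)] with x h1 h2
  rw [toPlane_ofPlane] at h1
  rw [mem_preimage, ← h2]
  change (j : ℝ) ≤ u x ↔ j ≤ ν (ofPlane x)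
  rw [h1, Nat.cast_le]

lemma FluxBound.congr {f g : ℝ × ℝ → ℝ} {C D : ℝ} (h : FluxBound f C) (hfg : f =ᵐ[volume] g)
    (hCD : C ≤ D) : FluxBound g D := by
  intro κ γ hκ hγ
  have h1 : ∫ p, g p * κ p = ∫ p, f p * κ p :=
    integral_congr_ae (hfg.mono fun p hp => by simp only [hp])
  have h2 : ∫ p, g p.swap * γ p = ∫ p, f p.swap * γ p :=
    integral_congr_ae ((ae_swap hfg).mono fun p hp => by simp only [hp])
  rw [h1, h2]
  linarith [h κ γ hκ hγ]

namespace IsProfile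
variable {ν : ℝ × ℝ → ℕ} {N : ℕ} {C M : ℝ}

lemma volume_real_level_pos (h : IsProfile ν N) (hpos : 0 < volume.real (level ν N)) :
    ∀ j ∈ Finset.Icc 1 N, 0 < volume.real (level ν j) := fun j hj => by
  rw [Finset.mem_Icc] at hj
  exact hpos.trans_le (h.volume_real_level_le hj.1 hj.2)

lemma two_sqrt_le (h : IsProfile ν N) : ∀ j ∈ Finset.Icc 1 N, 2 * √(volume.real (level ν j)) ≤
    volume.real (shadow (level ν j)) + volume.real (shadow (Prod.swap ⁻¹' level ν j)) :=
  fun j hj => two_sqrt_le_shadow (h.measurableSet_level j) (h.level_subset (Finset.mem_Icc.1 hj).1)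

lemma ae_eq_square (h : IsProfile ν N) (hN : 1 ≤ N) (hpos : 0 < volume.real (level ν N))
    (hM : ∫ p, (ν p : ℝ) = M) (hC : FluxBound (fun p => (ν p : ℝ)) (2 * √M)) :
    N = 1 ∧ ∃ s t, level ν 1 =ᵐ[volume]
      Ioo (s - √M / 2) (s + √M / 2) ×ˢ Ioo (t - √M / 2) (t + √M / 2) := by
  have hsum := h.integral_eq_sum
  rw [hM] at hsum
  have hle := h.sum_shadow_le hC
  obtain rfl : N = 1 :=
    eq_one_of_sum_le_sqrt hN (h.volume_real_level_pos hpos) h.two_sqrt_le (by rwa [← hsum])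
  have hS := h.two_sqrt_le 1 (by simp)
  have hsum' := hsum
  simp only [Finset.Icc_self, Finset.sum_singleton] at hle hsum'
  rw [hsum'] at hle hC ⊢
  refine ⟨rfl, h.exists_level_ae_eq_square hN hC ?_ hpos hle⟩
  simpa using hS

lemma ae_eq_octagon (h : IsProfile ν N) (hN : 1 ≤ N) (hpos : 0 < volume.real (level ν N))
    (hM : ∫ p, (ν p : ℝ) = M) (hM1 : 1 ≤ M) (hM2 : M ≤ 2)
    (hC : FluxBound (fun p => (ν p : ℝ)) (4 - 2 * √(2 - M))) :
    (N = 1 ∧ level ν 1 =ᵐ[volume] octagon (1 - √(2 - M) / 2)) ∨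
    (N = 2 ∧ M = 2 ∧ ∃ r ∈ Ioc (0 : ℝ) (1 / 2), level ν 1 =ᵐ[volume] octagon (1 - r) ∧
      ∃ s t, level ν 2 =ᵐ[volume] Ioo (s - r) (s + r) ×ˢ Ioo (t - r) (t + r)) := by
  have hsum := h.integral_eq_sum
  rw [hM] at hsum
  have hle := h.sum_shadow_le hC
  have hm := h.measurableSet_level 1
  have hs := h.level_subset le_rfl
  obtain ⟨hA1, rfl | ⟨rfl, rfl, hS1, hS2⟩⟩ := cases_of_sum_le hN (h.volume_real_level_pos hpos)
    (fun j hj => h.volume_real_level_le le_rfl (Finset.mem_Icc.1 hj).1) h.two_sqrt_le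
    (sqrt_le_shadow hm hs) hsum.symm hM1 hM2 hle
  · simp only [Finset.Icc_self, Finset.sum_singleton] at hle hsum
    rw [hsum] at hle ⊢
    exact .inl ⟨rfl, of_shadow_eq_sqrt hm hs hA1 hle⟩
  · have hIcc : Finset.Icc 1 2 = {1, 2} := rfl
    have hM' := hsum
    rw [hIcc, Finset.sum_pair (by simp)] at hM'
    have hA2 : 2 - volume.real (level ν 1) = volume.real (level ν 2) := by linarith
    have hr : 0 < √(volume.real (level ν 2)) := Real.sqrt_pos.2 hpos
    have hr1 : √(volume.real (level ν 2)) ≤ 1 := Real.sqrt_le_one.2 (by linarith)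
    refine .inr ⟨rfl, rfl, √(volume.real (level ν 2)) / 2, ⟨by linarith, by linarith⟩, ?_, ?_⟩
    · rw [← hA2]
      exact of_shadow_eq_sqrt hm hs hA1 hS1
    · refine h.exists_level_ae_eq_square hN hC ?_ hpos hS2
      rw [hIcc, Finset.sum_pair (by simp)]
      have := sqrt_le_shadow hm hs hA1
      have := h.two_sqrt_le 2 (by simp)
      rw [hA2] at *
      simp only [sub_self, Real.sqrt_zero]
      linarith

end IsProfile

lemma admissible_octagon {c : ℝ} (hc : 0 < c) (hc1 : c ≤ 1) :
    Admissible crysNorm unitSquare (volume.real (octagon c) / 2)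
      ((ofPlane ⁻¹' octagon c).indicator 1) := by
  have hsub : ofPlane ⁻¹' octagon c ⊆ unitSquare := by
    rw [unitSquare_eq]
    exact preimage_mono (octagon_subset_diamond c)
  have hcomp : (fun p => (ofPlane ⁻¹' octagon c).indicator (1 : (Fin 2 → ℝ) → ℝ) (toPlane p)) =
      (octagon c).indicator fun _ => 1 := by
    ext p
    by_cases hp : p ∈ octagon c <;> simp [hp]
  have hmeas := (isOpen_octagon c).measurableSet
  refine ⟨⟨?_, ?_⟩, .of_forall fun x hx => indicator_of_notMem (fun h => hx (hsub h)) _,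
    .of_forall fun x => ?_, ?_⟩
  · rw [← integrable_toPlane_iff, hcomp, integrable_indicator_iff hmeas]
    exact integrableOn_const (volume_ne_top (octagon_subset_diamond c))
  · exact ((anisoTV_octagon_le hc hc1).trans_lt ofReal_lt_top).ne
  · by_cases hx : x ∈ ofPlane ⁻¹' octagon c
    · exact ⟨1, by rw [indicator_of_mem hx]; simp⟩
    · exact ⟨0, by rw [indicator_of_notMem hx]; simp⟩
  · rw [setIntegral_eq_integral_of_forall_compl_eq_zero
      fun x hx => indicator_of_notMem (fun h => hx (hsub h)) _]
    have := integral_toPlane ((ofPlane ⁻¹' octagon c).indicator 1)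
    rw [hcomp] at this
    have h1 : ∫ p, (octagon c).indicator (fun _ => (1 : ℝ)) p = volume.real (octagon c) :=
      integral_indicator_one hmeas
    linarith

lemma exists_profile {m : ℝ} {u : (Fin 2 → ℝ) → ℝ} (hu : Admissible crysNorm unitSquare m u) {N : ℕ}
    (hN : IsEssSup u N) : ∃ ν, IsProfile ν N ∧ ∀ᵐ p, u (toPlane p) = ν p := by
  classical
  obtain ⟨⟨h_int, -⟩, hout, hnat, -⟩ := hu
  have hm := (integrable_toPlane_iff.2 h_int).aestronglyMeasurable
  refine ⟨fun p => if p ∈ diamond then min ⌊hm.mk _ p⌋₊ N else 0, ⟨?_, fun p => ?_, fun p hp => ?_⟩,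
    ?_⟩
  · exact Measurable.ite isOpen_diamond.measurableSet
      ((Nat.measurable_floor.comp hm.stronglyMeasurable_mk.measurable).min measurable_const)
      measurable_const
  · split_ifs
    exacts [min_le_right _ _, Nat.zero_le _]
  · by_contra h
    simp [h] at hp
  · filter_upwards [hm.ae_eq_mk, ae_toPlane_iff.2 hout, ae_toPlane_iff.2 hnat,
      ae_toPlane_iff.2 hN.1] with p h1 h2 ⟨k, h3⟩ h4
    split_ifs with hp
    · rw [← h1, h3, Nat.floor_natCast]
      rw [h3, Nat.cast_le] at h4
      rw [min_eq_left h4]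
    · rw [unitSquare_eq] at h2
      simpa using h2 (by simpa using hp)

section minimizer
variable {m : ℝ} {u : (Fin 2 → ℝ) → ℝ} {ν : ℝ × ℝ → ℕ} {N : ℕ}

lemma integral_profile (hu : Admissible crysNorm unitSquare m u)
    (hν : ∀ᵐ p, u (toPlane p) = ν p) : ∫ p, (ν p : ℝ) = 2 * m := by
  rw [← integral_congr_ae hν, integral_toPlane, ← hu.2.2.2,
    setIntegral_eq_integral_of_ae_compl_eq_zero hu.2.1]

lemma fluxBound_profile (hu : IsMinimizer crysNorm unitSquare m u)
    (hν : ∀ᵐ p, u (toPlane p) = ν p) {c : ℝ} (hc : 0 < c) (hc1 : c ≤ 1)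
    (hm : volume.real (octagon c) = 2 * m) : FluxBound (fun p => (ν p : ℝ)) (4 * c) := by
  refine (fluxBound_of_anisoTV hu.1.1.1 hu.1.1.2).congr hν ?_
  refine toReal_le_of_le_ofReal (by positivity) ((hu.2 _ ?_).trans (anisoTV_octagon_le hc hc1))
  have := admissible_octagon hc hc1
  rwa [hm, mul_div_cancel_left₀ _ two_ne_zero] at this

lemma one_le_essSup (hu : Admissible crysNorm unitSquare m u) (hm : 0 < m) (h : IsProfile ν N)
    (hν : ∀ᵐ p, u (toPlane p) = ν p) : 1 ≤ N := by
  by_contra! hN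
  have h0 : ∀ p, ν p = 0 := fun p => by have := h.le p; omega
  have := integral_profile hu hν
  simp [h0] at this
  linarith

lemma volume_real_level_pos (hN : IsEssSup u N) (hN1 : 1 ≤ N) (h : IsProfile ν N)
    (hν : ∀ᵐ p, u (toPlane p) = ν p) : 0 < volume.real (level ν N) := by
  refine ENNReal.toReal_pos (fun h0 => ?_) (volume_ne_top (h.level_subset hN1))
  have hle : ∀ᵐ x, u x ≤ (N : ℝ) - 1 := by
    rw [← ae_toPlane_iff]
    filter_upwards [hν, measure_eq_zero_iff_ae_notMem.1 h0] with p h1 h2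
    have h3 : ν p < N := not_le.1 fun hp => h2 hp
    rw [h1, le_sub_iff_add_le]
    exact_mod_cast Nat.succ_le_of_lt h3
  linarith [hN.2 _ hle]

end minimizer

/-- Minimizers of problem (1) in the unit square with the
crystalline norm `φ(ν) = |ν₁| + |ν₂|`, for `m ≤ 1` (cases (i)–(iii)). -/
theorem square_crystalline_small_mass (m : ℝ)
    (u : (Fin 2 → ℝ) → ℝ) (hu : IsMinimizer crysNorm unitSquare m u)
    (jbar : ℕ) (hjbar : IsEssSup u jbar) :
    -- (i)
    (0 < m → m ≤ 1 / 2 →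
      jbar = 1 ∧ ∃ x₀ : Fin 2 → ℝ,
        closure (densityPoints {x | (1 : ℝ) ≤ u x}) =
          closure (wulffBall crysNorm x₀ (Real.sqrt (m / 2))) ∧
        closure (wulffBall crysNorm x₀ (Real.sqrt (m / 2))) ⊆ closedUnitSquare) ∧
    -- (ii)
    (1 / 2 ≤ m → m < 1 →
      jbar = 1 ∧
        closure (densityPoints {x | (1 : ℝ) ≤ u x}) =
          closure (plaquette crysNorm unitSquare (Real.sqrt ((1 - m) / 2)))) ∧
    -- (iii)
    (m = 1 →
      (jbar = 1 ∧ closure (densityPoints {x | (1 : ℝ) ≤ u x}) = closure unitSquare) ∨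
      (jbar = 2 ∧ ∃ r ∈ Ioc (0 : ℝ) (1 / 2), ∃ x₀ : Fin 2 → ℝ,
        closure (densityPoints {x | (1 : ℝ) ≤ u x}) =
          closure (plaquette crysNorm unitSquare r) ∧
        closure (densityPoints {x | (2 : ℝ) ≤ u x}) =
          closure (wulffBall crysNorm x₀ r) ∧
        closure (wulffBall crysNorm x₀ r) ⊆ closure unitSquare)) := by
  have main : 0 < m → ∃ ν : ℝ × ℝ → ℕ, IsProfile ν jbar ∧ (∀ᵐ p, u (toPlane p) = ν p) ∧
      1 ≤ jbar ∧ 0 < volume.real (level ν jbar) := fun hm => by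
    obtain ⟨ν, hν, huν⟩ := exists_profile hu.1 hjbar
    have hN := one_le_essSup hu.1 hm hν huν
    exact ⟨ν, hν, huν, hN, volume_real_level_pos hjbar hN hν huν⟩
  have large : 1 / 2 ≤ m → m ≤ 1 → ∃ ν : ℝ × ℝ → ℕ, IsProfile ν jbar ∧
      (∀ᵐ p, u (toPlane p) = ν p) ∧
      ((jbar = 1 ∧ level ν 1 =ᵐ[volume] octagon (1 - √(2 - 2 * m) / 2)) ∨
      (jbar = 2 ∧ 2 * m = 2 ∧ ∃ r ∈ Ioc (0 : ℝ) (1 / 2), level ν 1 =ᵐ[volume] octagon (1 - r) ∧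
        ∃ s t, level ν 2 =ᵐ[volume] Ioo (s - r) (s + r) ×ˢ Ioo (t - r) (t + r))) := by
    intro hm hm1
    obtain ⟨ν, hν, huν, hN, hpos⟩ := main (by linarith)
    refine ⟨ν, hν, huν, hν.ae_eq_octagon hN hpos (integral_profile hu.1 huν) (by linarith)
      (by linarith) ?_⟩
    have h0 := Real.sqrt_nonneg (2 - 2 * m)
    have h1 : √(2 - 2 * m) ≤ 1 := Real.sqrt_le_one.2 (by linarith)
    have hc : volume.real (octagon (1 - √(2 - 2 * m) / 2)) = 2 * m := by
      rw [volume_real_octagon_of_ge (by linarith) (by linarith)]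
      linarith [Real.sq_sqrt (show 0 ≤ 2 - 2 * m by linarith)]
    convert fluxBound_profile hu huν (by linarith) (by linarith) hc using 1
    ring
  refine ⟨fun hm hm2 => ?_, fun hm hm1 => ?_, fun hm => ?_⟩
  · obtain ⟨ν, hν, huν, hN, hpos⟩ := main hm
    have hr : √(2 * m) / 2 = √(m / 2) := by
      rw [show 2 * m = 2 ^ 2 * (m / 2) by ring, Real.sqrt_mul (by norm_num),
        Real.sqrt_sq (by norm_num)]
      ring
    have hr0 : 0 < √(m / 2) := Real.sqrt_pos.2 (by linarith)
    have hr2 : √(m / 2) ≤ 1 / 2 := Real.sqrt_le_iff.2 ⟨by norm_num, by linarith⟩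
    have hc : volume.real (octagon √(m / 2)) = 2 * m := by
      rw [volume_real_octagon_of_le hr0 hr2, Real.sq_sqrt (by linarith)]
      ring
    have hC : FluxBound (fun p => (ν p : ℝ)) (2 * √(2 * m)) := by
      convert fluxBound_profile hu huν hr0 (by linarith) hc using 1
      rw [← hr]
      ring
    obtain ⟨hj, s, t, hst⟩ := hν.ae_eq_square hN hpos (integral_profile hu.1 huν) hC
    rw [hr] at hst
    refine ⟨hj, toPlane (s, t), ?_, ?_⟩
    · rw [wulffBall_crysNorm, ofPlane_toPlane]
      simpa using closure_densityPoints_level huν (isOpen_Ioo.prod isOpen_Ioo) hst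
    · rw [← closure_unitSquare]
      exact closure_wulffBall_subset (hν.level_subset le_rfl) hst
  · obtain ⟨ν, hν, huν, ⟨hj, h1⟩ | ⟨-, h2, -⟩⟩ := large hm hm1.le
    · have hr : √(2 - 2 * m) / 2 = √((1 - m) / 2) := by
        rw [show 2 - 2 * m = 2 ^ 2 * ((1 - m) / 2) by ring, Real.sqrt_mul (by norm_num),
          Real.sqrt_sq (by norm_num)]
        ring
      rw [hr] at h1
      refine ⟨hj, ?_⟩
      rw [plaquette_unitSquare (Real.sqrt_pos.2 (by linarith))
        (Real.sqrt_le_iff.2 ⟨by norm_num, by linarith⟩)]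
      simpa using closure_densityPoints_level huν (isOpen_octagon _) h1
    · linarith
  · obtain ⟨ν, hν, huν, ⟨hj, h1⟩ | ⟨hj, -, r, hr, h1, s, t, h2⟩⟩ := large (by linarith) hm.le
    · refine .inl ⟨hj, ?_⟩
      simp only [hm, mul_one, sub_self, Real.sqrt_zero, zero_div, sub_zero, octagon_one] at h1
      rw [unitSquare_eq]
      simpa using closure_densityPoints_level huν isOpen_diamond h1
    · refine .inr ⟨hj, r, hr, toPlane (s, t), ?_, ?_, ?_⟩
      · rw [plaquette_unitSquare hr.1 hr.2]
        simpa using closure_densityPoints_level huν (isOpen_octagon _) h1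
      · rw [wulffBall_crysNorm, ofPlane_toPlane]
        simpa using closure_densityPoints_level huν (isOpen_Ioo.prod isOpen_Ioo) h2
      · exact closure_wulffBall_subset (hν.level_subset one_le_two) h2

end
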